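/- arXiv:2412.20065 — 6 statements merged into one kernel-verified Lean document; each statement's English description precedes it below -/
import Mathlib

section
/- Let G be a group and H, K subgroups of G such that every element of H commutes with every element of K. Let f, h ∈ H and let m, n be positive integers such that fᵐ ∈ K and the commutator ⁅f, hⁿ⁆ = f⁻¹h⁻ⁿfhⁿ lies in K. Then f commutes with h^{mn}, i.e. ⁅f, h^{mn}⁆ = 1. -/
/-- If `x` conjugates `f * c` to `f` and commutes with `c`, then `x ^ k` conjugates `f * c ^ k`
to `f`. -/
theorem SemiconjBy.pow_left_mul_pow {M : Type*} [Monoid M] {x f c : M}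
    (hx : SemiconjBy x (f * c) f) (hxc : Commute x c) (k : ℕ) :
    SemiconjBy (x ^ k) (f * c ^ k) f := by
  induction k with
  | zero => simp
  | succ k ih =>
    have hmul : SemiconjBy x (f * c ^ (k + 1)) (f * c ^ k) := by
      rw [pow_succ', ← mul_assoc]
      exact hx.mul_right (hxc.pow_right k)
    rw [pow_succ x]
    exact ih.mul_left hmul

theorem commutator_trivial_of_amalgamated
    {G : Type*} [Group G] (H K : Subgroup G)
    (hcomm : ∀ a ∈ H, ∀ b ∈ K, a * b = b * a)
    (f h : G) (hf : f ∈ H) (hh : h ∈ H)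
    (m n : ℕ) (hm : 0 < m) (hn : 0 < n)
    (hfm : f ^ m ∈ K)
    (hcom : f⁻¹ * (h ^ n)⁻¹ * f * h ^ n ∈ K) :
    f⁻¹ * (h ^ (m * n))⁻¹ * f * h ^ (m * n) = 1 := by
  have hx : h ^ n ∈ H := H.pow_mem hh n
  rw [mul_comm m n, pow_mul]
  generalize h ^ n = x at hx hcom ⊢
  obtain ⟨c, hc⟩ : ∃ c, c = f⁻¹ * x⁻¹ * f * x := ⟨_, rfl⟩
  rw [← hc] at hcom
  have hfc : Commute f c := hcomm f hf c hcom
  have hxc : Commute x c := hcomm x hx c hcom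
  have hconj : SemiconjBy x (f * c) f := by
    rw [hc, SemiconjBy]
    group
  have hcm : c ^ m = 1 := by
    have hpow : x * (f ^ m * c ^ m) = x * f ^ m := by
      rw [← hfc.mul_pow, (hconj.pow_right m).eq, hcomm x hx _ hfm]
    simpa using hpow
  have hxm : x ^ m * f = f * x ^ m := by
    simpa [hcm] using (hconj.pow_left_mul_pow hxc m).eq
  rw [mul_assoc, ← hxm]
  group
end

section
/- Let δ ≥ 0 and let X be a geodesic δ-hyperbolic metric space. Let G be a group acting on X by isometries, and let H, K be subgroups of G such that: (i) G is generated by H ∪ K; (ii) every element of H commutes with every element of K; (iii) K is the kernel of the action, i.e. K = {g ∈ G : g·x = x for all x ∈ X}; (iv) the action has acylindrical image. Let h ∈ H and o ∈ X be such that h is loxodromic with quasi-geodesic orbit n ↦ hⁿ·o, set A = {hⁿ·o : n ∈ ℤ}, and let EC(h) = {x ∈ G : the Hausdorff distance between x·A and A is finite}. Then there exist a positive integer k and an element t ∈ G such that the centralizer C = C_G(h^k) = {x ∈ G : x h^k = h^k x} satisfies C ⊆ EC(h) and EC(h) ⊆ C ∪ tC; in particular, EC(h) contains the centralizer of h^k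 as a subgroup of index at most 2. -/
open Pointwise

/-- `γ` is a geodesic from `x` to `y`: an isometric embedding of `[0, d(x,y)]`
with the prescribed endpoints. -/
def IsGeodesicFrom {X : Type*} [MetricSpace X] (γ : ℝ → X) (x y : X) : Prop :=
  γ 0 = x ∧ γ (dist x y) = y ∧
    ∀ s ∈ Set.Icc (0 : ℝ) (dist x y), ∀ t ∈ Set.Icc (0 : ℝ) (dist x y),
      dist (γ s) (γ t) = |s - t|

/-- A metric space is geodesic if any two points are joined by a geodesic. -/
def IsGeodesicSpace (X : Type*) [MetricSpace X] : Prop :=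
  ∀ x y : X, ∃ γ : ℝ → X, IsGeodesicFrom γ x y

/-- A geodesic space is `δ`-hyperbolic if each side of any geodesic triangle is
contained in the closed `δ`-neighborhood of the union of the other two sides. -/
def IsDeltaHyperbolic (X : Type*) [MetricSpace X] (δ : ℝ) : Prop :=
  ∀ x y z : X, ∀ g₁ g₂ g₃ : ℝ → X,
    IsGeodesicFrom g₁ x y → IsGeodesicFrom g₂ y z → IsGeodesicFrom g₃ x z →
    ∀ p ∈ g₁ '' Set.Icc (0 : ℝ) (dist x y),
      ∃ q ∈ (g₂ '' Set.Icc (0 : ℝ) (dist y z)) ∪ (g₃ '' Set.Icc (0 : ℝ) (dist x z)),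
        dist p q ≤ δ

/-- The extra length incurred by travelling from `x` to `y` through `w`
(twice the Gromov product of `x` and `y` at `w`). -/
def detour {X : Type*} [MetricSpace X] (x w y : X) : ℝ := dist x w + dist w y - dist x y

/-- The Gromov four-point inequality, with constant `Q`, in terms of detours. -/
def IsFourPointHyperbolic (X : Type*) [MetricSpace X] (Q : ℝ) : Prop :=
  ∀ w x y z : X, detour x w y ≤ detour x w z + Q ∨ detour y w z ≤ detour x w z + Q

section MetricGeometry

variable {X : Type*} [MetricSpace X]

theorem IsGeodesicFrom.dist_left {γ : ℝ → X} {x y : X} (hγ : IsGeodesicFrom γ x y) {s : ℝ}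
    (hs : s ∈ Set.Icc 0 (dist x y)) : dist x (γ s) = s := by
  have h := hγ.2.2 0 ⟨le_rfl, dist_nonneg⟩ s hs
  rw [hγ.1, zero_sub, abs_neg, abs_of_nonneg hs.1] at h
  exact h

theorem IsGeodesicFrom.dist_right {γ : ℝ → X} {x y : X} (hγ : IsGeodesicFrom γ x y) {s : ℝ}
    (hs : s ∈ Set.Icc 0 (dist x y)) : dist (γ s) y = dist x y - s := by
  have h := hγ.2.2 s hs (dist x y) ⟨dist_nonneg, le_rfl⟩
  rw [hγ.2.1, abs_sub_comm, abs_of_nonneg (sub_nonneg.2 hs.2)] at h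
  exact h

theorem IsGeodesicFrom.dist_add_dist {γ : ℝ → X} {x y p : X} (hγ : IsGeodesicFrom γ x y)
    (hp : p ∈ γ '' Set.Icc 0 (dist x y)) : dist x p + dist p y = dist x y := by
  obtain ⟨s, hs, rfl⟩ := hp
  rw [hγ.dist_left hs, hγ.dist_right hs]
  ring

theorem IsGeodesicFrom.detour_le {γ : ℝ → X} {x y p : X} (hγ : IsGeodesicFrom γ x y)
    (hp : p ∈ γ '' Set.Icc 0 (dist x y)) (w : X) : detour x w y ≤ 2 * dist w p := by
  have h := hγ.dist_add_dist hp
  have h1 := dist_triangle x p w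
  have h2 := dist_triangle w p y
  rw [dist_comm p w] at h1
  unfold detour
  linarith

theorem detour_swap (x w y : X) : detour x w y = detour y w x := by
  rw [detour, detour, dist_comm y w, dist_comm w x, dist_comm y x]
  ring

/-- The detour at `w` between nearby points `x` and `y` is large when `w` is far away. -/
theorem le_detour_of_dist_le {x y w : X} {r : ℝ} (h : dist x y ≤ r) :
    2 * dist w x - 2 * r ≤ detour x w y := by
  have := dist_triangle w y x
  rw [dist_comm y x] at this
  rw [detour, dist_comm x w]
  linarith

/-- In a slim triangle, the distance from a vertex to the opposite side is at most the Gromov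
product plus `2δ`. -/
theorem IsDeltaHyperbolic.exists_dist_le {δ : ℝ} (hgeo : IsGeodesicSpace X)
    (hhyp : IsDeltaHyperbolic X δ) {x y : X} {γ : ℝ → X} (hγ : IsGeodesicFrom γ x y) (w : X) :
    ∃ p ∈ γ '' Set.Icc 0 (dist x y), 2 * dist w p ≤ detour x w y + 4 * δ := by
  obtain ⟨γ₂, h₂⟩ := hgeo y w
  obtain ⟨γ₃, h₃⟩ := hgeo x w
  set s : ℝ := detour w x y / 2 with hs
  have hs' : s ∈ Set.Icc 0 (dist x y) := by
    have h1 := dist_triangle w x y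
    have h2 := dist_triangle w y x
    rw [dist_comm y x] at h2
    constructor <;> rw [hs, detour] <;> linarith
  have hp : γ s ∈ γ '' Set.Icc 0 (dist x y) := ⟨s, hs', rfl⟩
  refine ⟨γ s, hp, ?_⟩
  have hxp := hγ.dist_left hs'
  have hpy := hγ.dist_right hs'
  obtain ⟨q, hq, hpq⟩ := hhyp x y w γ γ₂ γ₃ hγ h₂ h₃ _ hp
  have hwp := dist_triangle w q (γ s)
  rw [dist_comm q (γ s), dist_comm w q] at hwp
  rw [detour, dist_comm w x] at hs
  rw [detour, dist_comm w y] at *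
  rcases hq with hq | hq
  · have hq' := h₂.dist_add_dist hq
    have := dist_triangle (γ s) q y
    rw [dist_comm q y] at this
    linarith
  · have hq' := h₃.dist_add_dist hq
    have := dist_triangle x q (γ s)
    rw [dist_comm q (γ s)] at this
    linarith

theorem IsDeltaHyperbolic.isFourPointHyperbolic {δ : ℝ} (hgeo : IsGeodesicSpace X)
    (hhyp : IsDeltaHyperbolic X δ) : IsFourPointHyperbolic X (6 * δ) := by
  intro w x y z
  obtain ⟨γ, hγ⟩ := hgeo x z
  obtain ⟨γ₂, h₂⟩ := hgeo z y
  obtain ⟨γ₃, h₃⟩ := hgeo x y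
  obtain ⟨p, hp, hwp⟩ := hhyp.exists_dist_le hgeo hγ w
  obtain ⟨q, hq, hpq⟩ := hhyp x z y γ γ₂ γ₃ hγ h₂ h₃ p hp
  have hwq := dist_triangle w p q
  rcases hq with hq | hq
  · right
    have := h₂.detour_le hq w
    rw [detour_swap] at this
    linarith
  · left
    have := h₃.detour_le hq w
    linarith

/-- A bi-infinite sequence that is a quasi-geodesic and along which detours are bounded. -/
structure IsCoarseAxis (p : ℤ → X) (C s : ℝ) : Prop where
  lower : ∀ i j : ℤ, |(i : ℝ) - j| ≤ dist (p i) (p j)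
  upper : ∀ i j : ℤ, dist (p i) (p j) ≤ s * (|(i : ℝ) - j| + 1)
  detour_le : ∀ i j k : ℤ, i ≤ j → j ≤ k → detour (p i) (p j) (p k) ≤ C

/-- A homogeneous sequence with `d (p 0) (p 2)` much larger than `d (p 0) (p 1)` is a coarse axis. -/
theorem isCoarseAxis_of_homogeneous {Q : ℝ} (hQ : 0 ≤ Q) (hX : IsFourPointHyperbolic X Q)
    {p : ℤ → X} {a : ℕ → ℝ} (hp : ∀ (i : ℤ) (n : ℕ), dist (p i) (p (i + n)) = a n)
    (h2 : a 1 + 2 * Q + 1 ≤ a 2) {s : ℝ}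
    (hs : ∀ i j : ℤ, dist (p i) (p j) ≤ s * (|(i : ℝ) - j| + 1)) :
    IsCoarseAxis p (a 1 + Q) s := by
  have hp' : ∀ (i j : ℤ) (n : ℕ), j = i + n → dist (p i) (p j) = a n := by
    rintro i _ n rfl
    exact hp i n
  have h0 : a 0 = 0 := by simpa using (hp 0 0).symm
  have h21 : a 2 ≤ a 1 + a 1 := by
    have := dist_triangle (p 0) (p 1) (p 2)
    rwa [hp' 0 2 2 (by simp), hp' 0 1 1 (by simp), hp' 1 2 1 (by norm_num)] at this
  have hstep : ∀ n : ℕ, a n + Q + 1 ≤ a (n + 1) := by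
    have key : ∀ n : ℕ, a n + Q + 1 ≤ a (n + 1) ∧ a (n + 1) + Q + 1 ≤ a (n + 2) := by
      intro n
      induction n with
      | zero => constructor <;> simp only [zero_add] <;> linarith
      | succ n ih =>
        refine ⟨ih.2, ?_⟩
        have e02 : dist (p 0) (p 2) = a 2 := hp' _ _ _ (by simp)
        have e01 : dist (p 0) (p 1) = a 1 := hp' _ _ _ (by simp)
        have e12 : dist (p 1) (p 2) = a 1 := hp' _ _ _ (by norm_num)
        have e1n : dist (p 1) (p (n + 3)) = a (n + 2) := hp' _ _ _ (by push_cast; ring)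
        have e2n : dist (p 2) (p (n + 3)) = a (n + 1) := hp' _ _ _ (by push_cast; ring)
        have e0n : dist (p 0) (p (n + 3)) = a (n + 3) := hp' _ _ _ (by push_cast; ring)
        change a (n + 2) + Q + 1 ≤ a (n + 3)
        rcases hX (p 1) (p 0) (p (n + 3)) (p 2) with h | h
        · simp only [detour, e01, e12, e02, e1n, e0n] at h
          linarith
        · simp only [detour, e01, e12, e02, e1n, dist_comm (p (n + 3)), e2n] at h
          linarith [ih.1, ih.2]
    exact fun n => (key n).1
  have hgrow : ∀ n : ℕ, (n : ℝ) ≤ a n := by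
    intro n
    induction n with
    | zero => simp [h0]
    | succ n ih => push_cast; linarith [hstep n]
  refine ⟨fun i j => ?_, hs, fun i j k hij hjk => ?_⟩
  · rcases le_total i j with hij | hij
    · obtain ⟨n, rfl⟩ := Int.le.dest hij
      rw [hp, abs_sub_comm]
      push_cast
      simpa using hgrow n
    · obtain ⟨n, rfl⟩ := Int.le.dest hij
      rw [dist_comm, hp]
      push_cast
      simpa using hgrow n
  · obtain ⟨m, rfl⟩ := Int.le.dest hij
    obtain ⟨n, rfl⟩ := Int.le.dest hjk
    have e1 : dist (p i) (p (i + m)) = a m := hp _ _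
    have e2 : dist (p (i + m)) (p (i + m + n)) = a n := hp _ _
    have e3 : dist (p i) (p (i + m + n)) = a (m + n) := hp' _ _ _ (by push_cast; ring)
    rcases n with _ | n
    · simp only [detour, e1, e2, e3, h0, add_zero]
      linarith [hgrow 1]
    · have e4 : dist (p i) (p (i + m + 1)) = a (m + 1) := hp' _ _ _ (by push_cast; ring)
      have e5 : dist (p (i + m)) (p (i + m + 1)) = a 1 := hp' _ _ _ (by simp)
      have e6 : dist (p (i + m + 1)) (p (i + m + (n + 1 : ℕ))) = a n :=
        hp' _ _ _ (by push_cast; ring)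
      have hm := hstep m
      have hn := hstep n
      rcases hX (p (i + m)) (p i) (p (i + m + (n + 1 : ℕ))) (p (i + m + 1)) with h | h
      · simp only [detour, e1, e2, e3, e4, e5] at h ⊢
        linarith
      · rw [detour, detour, dist_comm (p (i + m + (n + 1 : ℕ))), e2, e5,
          dist_comm (p (i + m + (n + 1 : ℕ))), e6, e1, e4] at h
        linarith

namespace IsCoarseAxis

variable {p q : ℤ → X} {C s : ℝ}

theorem nonneg_detour (hp : IsCoarseAxis p C s) : 0 ≤ C := by
  simpa [detour] using hp.detour_le 0 0 0 le_rfl le_rfl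

theorem congr (hp : IsCoarseAxis p C s) (hq : ∀ i j, dist (q i) (q j) = dist (p i) (p j)) :
    IsCoarseAxis q C s where
  lower i j := by rw [hq]; exact hp.lower i j
  upper i j := by rw [hq]; exact hp.upper i j
  detour_le i j k hij hjk := by
    simpa only [detour, hq] using hp.detour_le i j k hij hjk

theorem dist_le_of_le (hp : IsCoarseAxis p C s) {i j k : ℤ} (hik : i ≤ k) (hjk : j ≤ k) :
    dist (p i) (p j) ≤ |dist (p i) (p k) - dist (p j) (p k)| + C := by
  rcases le_total i j with hij | hij
  · have := hp.detour_le i j k hij hjk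
    rw [detour] at this
    linarith [le_abs_self (dist (p i) (p k) - dist (p j) (p k))]
  · have := hp.detour_le j i k hij hik
    rw [detour, dist_comm] at this
    linarith [neg_abs_le (dist (p i) (p k) - dist (p j) (p k))]

theorem dist_le_of_ge (hp : IsCoarseAxis p C s) {i j k : ℤ} (hik : k ≤ i) (hjk : k ≤ j) :
    dist (p i) (p j) ≤ |dist (p i) (p k) - dist (p j) (p k)| + C := by
  rw [dist_comm (p i) (p k), dist_comm (p j) (p k)]
  rcases le_total i j with hij | hij
  · have := hp.detour_le k i j hik hij
    rw [detour] at this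
    linarith [neg_abs_le (dist (p k) (p i) - dist (p k) (p j))]
  · have := hp.detour_le k j i hjk hij
    rw [detour, dist_comm (p j)] at this
    linarith [le_abs_self (dist (p k) (p i) - dist (p k) (p j))]

theorem dist_le_of_same_side (hp : IsCoarseAxis p C s) {i j : ℤ}
    (h : 0 ≤ i ∧ 0 ≤ j ∨ i ≤ 0 ∧ j ≤ 0) :
    dist (p i) (p j) ≤ |dist (p i) (p 0) - dist (p j) (p 0)| + C :=
  h.elim (fun h => hp.dist_le_of_ge h.1 h.2) fun h => hp.dist_le_of_le h.1 h.2

theorem detour_zero_le (hp : IsCoarseAxis p C s) {i j : ℤ}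
    (h : i ≤ 0 ∧ 0 ≤ j ∨ 0 ≤ i ∧ j ≤ 0) : detour (p i) (p 0) (p j) ≤ C := by
  rcases h with h | h
  · exact hp.detour_le i 0 j h.1 h.2
  · rw [detour_swap]
    exact hp.detour_le j 0 i h.2 h.1

/-- A copy of a coarse axis contained in a bounded neighborhood of it fellow-travels it,
in one of the two directions. -/
theorem fellow_travel_or_reverse (hp : IsCoarseAxis p C s)
    (hsymm : ∀ m, dist (p (-m)) (p 0) = dist (p m) (p 0))
    (hq : ∀ i j, dist (q i) (q j) = dist (p i) (p j))
    {r : ℝ} (hr : ∀ m, ∃ j, dist (q m) (p j) ≤ r) :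
    (∃ R, ∀ m, dist (q m) (p m) ≤ R) ∨ (∃ R, ∀ m, dist (q m) (p (-m)) ≤ R) := by
  choose f hf using hr
  have hC := hp.nonneg_detour
  have hr0 : 0 ≤ r := dist_nonneg.trans (hf 0)
  set r' : ℝ := r + dist (q 0) (p 0) with hr'
  have hrr' : r ≤ r' := by linarith [dist_nonneg (x := q 0) (y := p 0)]
  have hf0 : ∀ m, |dist (p m) (p 0) - dist (p (f m)) (p 0)| ≤ r' := by
    intro m
    rw [← hq m 0]
    have h1 := dist_triangle4 (q m) (p (f m)) (p 0) (q 0)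
    have h2 := dist_triangle4 (p (f m)) (q m) (q 0) (p 0)
    rw [dist_comm (p 0)] at h1
    rw [dist_comm (p (f m)) (q m)] at h2
    rw [abs_le]
    constructor <;> linarith [hf m]
  have hff : ∀ m n, |dist (p m) (p n) - dist (p (f m)) (p (f n))| ≤ 2 * r := by
    intro m n
    rw [← hq m n]
    have h1 := dist_triangle4 (q m) (p (f m)) (p (f n)) (q n)
    have h2 := dist_triangle4 (p (f m)) (q m) (q n) (p (f n))
    rw [dist_comm (p (f n))] at h1
    rw [dist_comm (p (f m)) (q m)] at h2
    rw [abs_le]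
    constructor <;> linarith [hf m, hf n]
  have hdet : ∀ m n, |detour (p m) (p 0) (p n) - detour (p (f m)) (p 0) (p (f n))| ≤ 4 * r' := by
    intro m n
    have h1 := abs_le.1 (hf0 m)
    have h2 := abs_le.1 (hf0 n)
    have h3 := abs_le.1 (hff m n)
    rw [detour, detour, dist_comm (p 0), dist_comm (p 0), abs_le]
    constructor <;> linarith
  obtain ⟨M, hM⟩ := exists_nat_gt (C + 3 * r')
  have hMr : 0 < (M : ℝ) := by linarith
  have hfar : ∀ m : ℤ, (M : ℤ) ≤ |m| → (M : ℝ) ≤ dist (p m) (p 0) := by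
    intro m hm
    have h1 := hp.lower m 0
    have h2 : ((M : ℤ) : ℝ) ≤ ((|m| : ℤ) : ℝ) := by exact_mod_cast hm
    push_cast at h1 h2
    rw [sub_zero] at h1
    linarith
  -- points on the same side of the base point stay on the same side
  have hsame : ∀ m n : ℤ, (M : ℤ) ≤ m → (M : ℤ) ≤ n → 0 ≤ f m → 0 ≤ f n := by
    intro m n hm hn hfm
    by_contra! hfn
    have h1 := hp.dist_le_of_ge (i := m) (j := n) (k := 0) (by omega) (by omega)
    have h2 := hp.detour_zero_le (.inr ⟨hfm, hfn.le⟩)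
    have h3 := abs_le.1 (hdet m n)
    have h4 := hfar m (hm.trans (le_abs_self _))
    have h5 := hfar n (hn.trans (le_abs_self _))
    have h6 : 2 * (M : ℝ) - C ≤ detour (p m) (p 0) (p n) := by
      rw [detour, dist_comm (p 0)]
      rcases abs_cases (dist (p m) (p 0) - dist (p n) (p 0)) with h | h <;> linarith
    linarith
  -- points on opposite sides of the base point stay on opposite sides
  have hopp : ∀ m n : ℤ, m ≤ -(M : ℤ) → (M : ℤ) ≤ n →
      ¬ (0 ≤ f m ∧ 0 ≤ f n ∨ f m ≤ 0 ∧ f n ≤ 0) := by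
    intro m n hm hn hfmn
    have h1 := hp.detour_zero_le (i := m) (j := n) (.inl ⟨by omega, by omega⟩)
    have h2 := hp.dist_le_of_same_side hfmn
    have h3 := abs_le.1 (hdet m n)
    have h4 := hfar m ((le_neg_of_le_neg hm).trans (neg_le_abs _))
    have h5 := hfar n (hn.trans (le_abs_self _))
    have h4' := abs_le.1 (hf0 m)
    have h5' := abs_le.1 (hf0 n)
    have h6 : 2 * ((M : ℝ) - r') - C ≤ detour (p (f m)) (p 0) (p (f n)) := by
      rw [detour, dist_comm (p 0)]
      rcases abs_cases (dist (p (f m)) (p 0) - dist (p (f n)) (p 0)) with h | h <;> linarith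
    linarith
  have hnear : ∀ m n : ℤ, |m| < M → dist (p n) (p 0) = dist (p m) (p 0) →
      dist (q m) (p n) ≤ 2 * (|s| * (M + 1)) + r' := by
    intro m n hm hn
    have h1 := hp.upper m 0
    have h2 : ((|m| : ℤ) : ℝ) < ((M : ℤ) : ℝ) := by exact_mod_cast hm
    push_cast at h1 h2
    rw [sub_zero] at h1
    have h3 : s * (|(m : ℝ)| + 1) ≤ |s| * (M + 1) :=
      mul_le_mul (le_abs_self s) (by linarith) (by positivity) (abs_nonneg s)
    have h4 := dist_triangle4 (q m) (q 0) (p 0) (p n)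
    rw [hq, dist_comm (p 0), hn] at h4
    linarith
  have hside : ∀ m n : ℤ, dist (p n) (p 0) = dist (p m) (p 0) →
      (0 ≤ f m ∧ 0 ≤ n ∨ f m ≤ 0 ∧ n ≤ 0) → dist (q m) (p n) ≤ r + r' + C := by
    intro m n hn h
    have h1 := hp.dist_le_of_same_side h
    rw [hn, abs_sub_comm] at h1
    linarith [dist_triangle (q m) (p (f m)) (p n), hf m, hf0 m]
  rcases le_or_gt 0 (f M) with hfM | hfM
  · refine .inl ⟨max (2 * (|s| * (M + 1)) + r') (r + r' + C), fun m => ?_⟩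
    rcases lt_or_ge |m| M with hm | hm
    · exact (hnear m m hm rfl).trans (le_max_left _ _)
    · refine (hside m m rfl ?_).trans (le_max_right _ _)
      rcases le_abs.1 hm with hm | hm
      · exact .inl ⟨hsame M m le_rfl hm hfM, by omega⟩
      · have := hopp m M (by omega) le_rfl
        exact .inr ⟨by omega, by omega⟩
  · refine .inr ⟨max (2 * (|s| * (M + 1)) + r') (r + r' + C), fun m => ?_⟩
    rcases lt_or_ge |m| M with hm | hm
    · exact (hnear m (-m) hm (hsymm m)).trans (le_max_left _ _)
    · refine (hside m (-m) (hsymm m) ?_).trans (le_max_right _ _)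
      rcases le_abs.1 hm with hm | hm
      · have := hsame m M hm le_rfl
        exact .inr ⟨by omega, by omega⟩
      · have := hopp m M (by omega) le_rfl
        exact .inl ⟨by omega, by omega⟩

/-- A copy of a coarse axis at bounded distance from it lies in a neighborhood of it whose radius
does not depend on the copy. -/
theorem exists_dist_le {Q : ℝ} (hX : IsFourPointHyperbolic X Q) (hQ : 0 ≤ Q)
    (hp : IsCoarseAxis p C s)
    (hq : ∀ i j, dist (q i) (q j) = dist (p i) (p j)) {r : ℝ} (hr : ∀ m, dist (q m) (p m) ≤ r)
    (m : ℤ) : ∃ j, dist (q m) (p j) ≤ 2 * C + 2 * Q + 2 * s := by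
  have hC := hp.nonneg_detour
  have hs : 0 ≤ s := by simpa using hp.upper 0 0
  have hqa := hp.congr hq
  obtain ⟨M, hM⟩ := exists_nat_gt (C + 2 * Q + r)
  have hr0 : 0 ≤ r := dist_nonneg.trans (hr 0)
  have hfar₁ : (M : ℝ) ≤ dist (q m) (q (m + M)) := by
    simpa using hqa.lower m (m + M)
  have hfar₂ : (M : ℝ) ≤ dist (q m) (q (m - M)) := by
    simpa using hqa.lower m (m - M)
  have hend : detour (p (m - M)) (q m) (p (m + M)) ≤ C + 2 * Q := by
    have h0 := hqa.detour_le (m - M) m (m + M) (by omega) (by omega)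
    have h1 := le_detour_of_dist_le (w := q m) (hr (m + M))
    have h2 := le_detour_of_dist_le (w := q m) (hr (m - M))
    have h3 : detour (q (m - M)) (q m) (p (m + M)) ≤ C + Q := by
      rcases hX (q m) (q (m - M)) (p (m + M)) (q (m + M)) with h | h
      · linarith
      · rw [detour_swap] at h
        linarith
    rcases hX (q m) (q (m - M)) (p (m - M)) (p (m + M)) with h | h <;> linarith
  have hmid : ∀ j, m - M ≤ j → j ≤ m + M →
      detour (p (m - M)) (p j) (q m) ≤ C + Q ∨ detour (q m) (p j) (p (m + M)) ≤ C + Q := by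
    intro j h1 h2
    have h0 := hp.detour_le (m - M) j (m + M) h1 h2
    rcases hX (p j) (p (m - M)) (q m) (p (m + M)) with h | h
    · exact .inl (by linarith)
    · exact .inr (by linarith)
  obtain ⟨j, hj₁, hj₂⟩ : ∃ j, detour (p (m - M)) (p j) (q m) ≤ C + Q ∧
      (detour (q m) (p j) (p (m + M)) ≤ C + Q ∨
        detour (q m) (p (j + 1)) (p (m + M)) ≤ C + Q) := by
    by_contra! hcon
    have hall : ∀ n : ℕ, n ≤ 2 * M → detour (p (m - M)) (p (m - M + n)) (q m) ≤ C + Q := by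
      intro n
      induction n with
      | zero => intro; simp [detour]; linarith
      | succ n ih =>
        intro hn
        have h1 := (hcon _ (ih (by omega))).2
        rw [add_assoc] at h1
        exact (hmid (m - M + (n + 1 : ℕ)) (by omega) (by omega)).resolve_right (not_le.2 h1)
    have h1 := hall (2 * M) le_rfl
    have h2 : m - M + (2 * M : ℕ) = m + M := by push_cast; ring
    rw [h2] at h1
    have h3 := (hcon _ h1).1
    simp only [detour, dist_self] at h3
    linarith
  refine ⟨j, ?_⟩
  have hjj : dist (p j) (p (j + 1)) ≤ 2 * s := by
    have := hp.upper j (j + 1)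
    norm_num at this
    linarith
  have hj₃ : detour (q m) (p j) (p (m + M)) ≤ C + Q + 4 * s := by
    rcases hj₂ with h | h
    · linarith
    · rw [detour] at h ⊢
      have h1 := dist_triangle (q m) (p (j + 1)) (p j)
      have h2 := dist_triangle (p j) (p (j + 1)) (p (m + M))
      rw [dist_comm (p (j + 1)) (p j)] at h1
      linarith
  rw [detour] at hj₁ hj₃ hend
  have h1 := dist_triangle (p (m - M)) (p j) (p (m + M))
  rw [dist_comm (p j) (q m)] at hj₁
  rw [dist_comm (q m) (p (m + M)), dist_comm (p (m + M)) (q m)] at *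
  linarith

/-- A copy of a coarse axis fellow-travelling it does so at a distance depending only on the
distance between the base points. -/
theorem dist_le_of_fellow_travel {Q : ℝ} (hX : IsFourPointHyperbolic X Q) (hQ : 0 ≤ Q)
    (hp : IsCoarseAxis p C s)
    (hq : ∀ i j, dist (q i) (q j) = dist (p i) (p j)) {r : ℝ} (hr : ∀ m, dist (q m) (p m) ≤ r)
    {r₁ : ℝ} (hr₁ : ∀ m, ∃ j, dist (q m) (p j) ≤ r₁) (h0 : dist (q 0) (p 0) ≤ r₁) (m : ℤ) :
    dist (q m) (p m) ≤ 3 * r₁ + 2 * C + Q := by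
  have hC := hp.nonneg_detour
  have hqa := hp.congr hq
  obtain ⟨j, hj⟩ := hr₁ m
  obtain ⟨M, hM⟩ := exists_nat_gt (C + Q + r + |(m : ℝ)| + |(j : ℝ)|)
  have hr0 : 0 ≤ r := dist_nonneg.trans (hr 0)
  have hMm : m ≤ M ∧ j ≤ M ∧ (0 : ℤ) ≤ M := by
    refine ⟨?_, ?_, by omega⟩
    · have : (m : ℝ) ≤ (M : ℤ) := by
        push_cast
        linarith [le_abs_self (m : ℝ), abs_nonneg (j : ℝ)]
      exact_mod_cast this
    · have : (j : ℝ) ≤ (M : ℤ) := by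
        push_cast
        linarith [le_abs_self (j : ℝ), abs_nonneg (m : ℝ)]
      exact_mod_cast this
  have hfar : ∀ i : ℤ, |(i : ℝ)| ≤ |(m : ℝ)| → (M : ℝ) - |(m : ℝ)| ≤ dist (q i) (q M) := by
    intro i hi
    have h1 := hqa.lower i M
    have h2 := neg_abs_le ((i : ℝ) - (M : ℤ))
    have h3 := le_abs_self (i : ℝ)
    push_cast at h1 h2
    linarith
  have hdet : ∀ i k : ℤ, i ≤ k → k ≤ M → |(k : ℝ)| ≤ |(m : ℝ)| →
      detour (q i) (q k) (p M) ≤ C + Q := by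
    intro i k hik hkM hk
    have h1 := hqa.detour_le i k M hik hkM
    have h2 := le_detour_of_dist_le (w := q k) (hr M)
    have h3 := hfar k hk
    rcases hX (q k) (q i) (p M) (q M) with h | h
    · linarith
    · rw [detour_swap] at h
      linarith [abs_nonneg (j : ℝ)]
  have hclose : |dist (q m) (p M) - dist (p m) (p M)| ≤ r₁ + C + Q := by
    have h1 := abs_dist_sub_le (q 0) (p 0) (p M)
    have h2 := abs_le.1 (h1.trans h0)
    rw [abs_le]
    rcases le_total 0 m with hm | hm
    · have h3 := hdet 0 m hm hMm.1 le_rfl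
      have h4 := hp.detour_le 0 m M hm hMm.1
      have h5 := dist_triangle (q 0) (q m) (p M)
      have h6 := dist_triangle (p 0) (p m) (p M)
      rw [detour, hq] at h3
      rw [detour] at h4
      rw [hq] at h5
      constructor <;> linarith
    · have h3 := hdet m 0 hm hMm.2.2 (by simp)
      have h4 := hp.detour_le m 0 M hm hMm.2.2
      have h5 := dist_triangle (q m) (q 0) (p M)
      have h6 := dist_triangle (p m) (p 0) (p M)
      rw [detour, hq] at h3
      rw [detour] at h4
      rw [hq] at h5
      constructor <;> linarith
  have h1 := hp.dist_le_of_le hMm.2.1 hMm.1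
  have h2 := abs_le.1 ((abs_dist_sub_le (q m) (p j) (p M)).trans hj)
  have h3 := abs_le.1 hclose
  have h4 : |dist (p j) (p M) - dist (p m) (p M)| ≤ 2 * r₁ + C + Q := by
    rw [abs_le]
    constructor <;> linarith
  linarith [dist_triangle (q m) (p j) (p m)]

end IsCoarseAxis

end MetricGeometry

section GroupTheory

theorem Set.Finite.exists_pos_forall_of_dvd {α : Type*} {S : Set α} (hS : S.Finite)
    {P : α → ℕ → Prop} (h : ∀ u ∈ S, ∃ l, 0 < l ∧ P u l)
    (hmul : ∀ u l k, P u l → P u (l * k)) : ∃ n, 0 < n ∧ ∀ u ∈ S, P u n := by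
  induction S, hS using Set.Finite.induction_on with
  | empty => exact ⟨1, one_pos, by simp⟩
  | insert _ _ ih =>
    obtain ⟨n, hn, hn'⟩ := ih fun u hu => h u (Set.mem_insert_of_mem _ hu)
    obtain ⟨l, hl, hl'⟩ := h _ (Set.mem_insert _ _)
    refine ⟨l * n, Nat.mul_pos hl hn, ?_⟩
    rintro u (rfl | hu)
    · exact hmul _ _ _ hl'
    · rw [mul_comm]
      exact hmul _ _ _ (hn' u hu)

variable {G P : Type*} [Group G] [Group P]

/-- If conjugation by `γ` preserves a set with finite image under `φ`, then the image commutes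
with the image of a power of `γ`. -/
theorem exists_pow_commute_map (φ : G →* P) {γ : G} {Y : Set G} (hfin : (φ '' Y).Finite)
    (hconj : ∀ y ∈ Y, γ⁻¹ * y * γ ∈ Y) :
    ∃ n, 0 < n ∧ ∀ y ∈ Y, Commute (φ y) (φ γ ^ n) := by
  have hperiodic : ∀ u ∈ φ '' Y, ∃ l, 0 < l ∧ Commute u (φ γ ^ l) := by
    rintro _ ⟨y, hy, rfl⟩
    have hiter : ∀ i : ℕ, (γ ^ i)⁻¹ * y * γ ^ i ∈ Y := by
      intro i
      induction i with
      | zero => simpa using hy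
      | succ i ih => simpa [pow_succ, mul_assoc] using hconj _ ih
    obtain ⟨i, j, hij, heq⟩ := hfin.exists_lt_map_eq_of_forall_mem
      (f := fun i : ℕ => φ ((γ ^ i)⁻¹ * y * γ ^ i))
      fun i => Set.mem_image_of_mem _ (hiter i)
    obtain ⟨l, rfl⟩ := Nat.exists_eq_add_of_lt hij
    refine ⟨l + 1, Nat.succ_pos l, ?_⟩
    simp only [map_mul, map_inv, map_pow] at heq
    rw [add_assoc, add_comm i, pow_add] at heq
    rw [commute_iff_eq]
    generalize φ γ ^ (l + 1) = c at *
    generalize φ γ ^ i = d at *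
    generalize φ y = u at *
    have h : u = c⁻¹ * u * c := by
      have h1 : d⁻¹ * u * d = d⁻¹ * (c⁻¹ * u * c) * d := by
        rw [heq, mul_inv_rev]
        simp only [mul_assoc]
      exact mul_left_cancel (mul_right_cancel h1)
    rw [mul_assoc, eq_inv_mul_iff_mul_eq] at h
    exact h.symm
  obtain ⟨n, hn, h⟩ := hfin.exists_pos_forall_of_dvd hperiodic
    fun u l k h => by rw [pow_mul]; exact h.pow_right k
  exact ⟨n, hn, fun y hy => h _ (Set.mem_image_of_mem _ hy)⟩

/-- If `G` is generated by a subgroup `H` and the kernel of `φ`, and these commute, then an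
element of `H` has a power commuting with every element of a subgroup `E` as soon as `E` is covered
by the `⟨γ⟩`-translates of a `γ`-invariant set with finite image. -/
theorem exists_pow_commute (φ : G →* P) {H : Subgroup G}
    (hgen : Subgroup.closure ((H : Set G) ∪ (φ.ker : Set G)) = ⊤)
    (hcomm : ∀ a ∈ H, ∀ b ∈ φ.ker, a * b = b * a) {γ : G} (hγ : γ ∈ H)
    {Y : Set G} (hfin : (φ '' Y).Finite) (hconj : ∀ y ∈ Y, γ⁻¹ * y * γ ∈ Y)
    {E : Subgroup G} (hE : ∀ x ∈ E, ∃ i : ℤ, γ ^ i * x ∈ Y) :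
    ∃ n, 0 < n ∧ ∀ x ∈ E, Commute x (γ ^ n) := by
  obtain ⟨n, hn, hn'⟩ := exists_pow_commute_map φ hfin hconj
  have hnormal : ∀ x, ∀ a ∈ H, x * a * x⁻¹ ∈ H := by
    intro x
    have hx : x ∈ Subgroup.closure ((H : Set G) ∪ (φ.ker : Set G)) := hgen ▸ Subgroup.mem_top x
    induction hx using Subgroup.closure_induction'' with
    | one => simp
    | mem x hx =>
      intro a ha
      rcases hx with hx | hx
      · exact H.mul_mem (H.mul_mem hx ha) (H.inv_mem hx)
      · rw [← hcomm a ha x hx, mul_inv_cancel_right]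
        exact ha
    | inv_mem x hx =>
      intro a ha
      rcases hx with hx | hx
      · exact H.mul_mem (H.mul_mem (H.inv_mem hx) ha) (H.inv_mem (H.inv_mem hx))
      · rw [← hcomm a ha _ (inv_mem hx), mul_inv_cancel_right]
        exact ha
    | mul x y _ _ hx hy =>
      intro a ha
      simpa [mul_assoc] using hx _ (hy a ha)
  have hcentral : ∀ z ∈ H, z ∈ φ.ker → ∀ x, Commute x z := by
    intro z hzH hzK x
    have hx : x ∈ Subgroup.closure ((H : Set G) ∪ (φ.ker : Set G)) := hgen ▸ Subgroup.mem_top x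
    induction hx using Subgroup.closure_induction with
    | one => exact Commute.one_left z
    | mem x hx => exact hx.elim (fun hx => hcomm x hx z hzK) fun hx => (hcomm z hzH x hx).symm
    | inv x _ hx => exact hx.inv_left
    | mul x y _ _ hx hy => exact hx.mul_left hy
  set g := γ ^ n with hg
  set z : G → G := fun x => x * g * x⁻¹ * g⁻¹ with hz
  have hgH : g ∈ H := H.pow_mem hγ n
  have hzH : ∀ x, z x ∈ H := fun x => H.mul_mem (hnormal x g hgH) (H.inv_mem hgH)
  have hzker : ∀ x ∈ E, z x ∈ φ.ker := by
    intro x hx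
    obtain ⟨i, hi⟩ := hE x hx
    have h1 : Commute (φ x) (φ g) := by
      have h2 := hn' _ hi
      have h3 : Commute ((φ γ ^ i)⁻¹) (φ γ ^ n) := ((Commute.refl _).zpow_left i).inv_left.pow_right n
      simpa [hg] using h3.mul_left h2
    rw [MonoidHom.mem_ker]
    simp only [hz, map_mul, map_inv]
    rw [h1.eq]
    group
  have hzcomm : ∀ x ∈ E, ∀ y, Commute y (z x) := fun x hx => hcentral _ (hzH x) (hzker x hx)
  have hsemi : ∀ x, SemiconjBy x g (z x * g) := by
    intro x
    rw [SemiconjBy]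
    simp only [hz]
    group
  have hz_of_semi : ∀ x w, SemiconjBy x g (w * g) → z x = w := by
    intro x w h
    simp only [hz]
    rw [h.eq]
    group
  have hzpow : ∀ x ∈ E, ∀ i : ℕ, z (x ^ i) = z x ^ i := by
    intro x hx i
    refine hz_of_semi _ _ ?_
    induction i with
    | zero => simp
    | succ i ih =>
      rw [pow_succ x, pow_succ' (z x), mul_assoc]
      exact SemiconjBy.mul_left (SemiconjBy.mul_right (hzcomm x hx (x ^ i)) ih) (hsemi x)
  have hzshift : ∀ x ∈ E, ∀ i : ℤ, z (γ ^ i * x) = z x := by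
    intro x hx i
    refine hz_of_semi _ _ (SemiconjBy.mul_left (y := z x * g) ?_ (hsemi x))
    exact SemiconjBy.mul_right (hzcomm x hx _) (((Commute.refl γ).zpow_left i).pow_right n)
  have hzφ : ∀ x y, φ x = φ y → z x = z y := by
    intro x y h
    obtain ⟨b, hb, rfl⟩ : ∃ b ∈ φ.ker, x = y * b :=
      ⟨y⁻¹ * x, by simp [MonoidHom.mem_ker, h], by simp⟩
    exact hz_of_semi _ _ ((hsemi y).mul_left (hcomm g hgH b hb).symm)
  have hzfin : (z '' E).Finite := by
    refine (hfin.image fun u => z (Function.invFun φ u)).subset ?_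
    rintro _ ⟨x, hx, rfl⟩
    obtain ⟨i, hi⟩ := hE x hx
    refine ⟨_, Set.mem_image_of_mem φ hi, ?_⟩
    rw [← hzshift x hx i]
    exact hzφ _ _ (Function.invFun_eq ⟨_, rfl⟩)
  have hperiodic : ∀ u ∈ z '' E, ∃ l, 0 < l ∧ u ^ l = 1 := by
    rintro _ ⟨x, hx, rfl⟩
    obtain ⟨i, j, hij, heq⟩ := hzfin.exists_lt_map_eq_of_forall_mem (f := fun i : ℕ => z (x ^ i))
      fun i => Set.mem_image_of_mem _ (E.pow_mem hx i)
    obtain ⟨l, rfl⟩ := Nat.exists_eq_add_of_lt hij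
    refine ⟨l + 1, Nat.succ_pos l, ?_⟩
    simp only [hzpow x hx] at heq
    rw [add_assoc, pow_add] at heq
    exact left_eq_mul.1 heq
  obtain ⟨m, hm, hm'⟩ := hzfin.exists_pos_forall_of_dvd hperiodic
    fun u l k h => by rw [pow_mul, h, one_pow]
  refine ⟨n * m, Nat.mul_pos hn hm, fun x hx => ?_⟩
  have h1 := (hsemi x).pow_right m
  rw [(hzcomm x hx g).symm.mul_pow, hm' _ (Set.mem_image_of_mem _ hx), one_mul] at h1
  rw [pow_mul]
  exact h1

end GroupTheory

section Action

variable {X G : Type*} [MetricSpace X] [Group G] [MulAction G X]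

/-- A sequence bounded below by a linear one makes arbitrarily large jumps under doubling. -/
theorem exists_pos_add_le_double {a : ℕ → ℝ} {lam c : ℝ} (hlam : 1 ≤ lam)
    (ha : ∀ n : ℕ, 1 / lam * n - c ≤ a n) (B : ℝ) :
    ∃ N, 0 < N ∧ a N + B ≤ a (2 * N) := by
  by_contra! hcon
  have hub : ∀ i : ℕ, a (2 ^ i) ≤ a 1 + |B| * i := by
    intro i
    induction i with
    | zero => simp
    | succ i ih =>
      have := hcon (2 ^ i) (by positivity)
      rw [← pow_succ'] at this
      push_cast
      linarith [le_abs_self B]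
  have hlam0 : 0 < lam := by linarith
  obtain ⟨i, hi⟩ := exists_nat_gt (lam * (|a 1| + |c| + 2 * |B|))
  have h1 := (ha (2 ^ (2 * i))).trans (hub (2 * i))
  have h2 : (i : ℝ) + 1 ≤ 2 ^ i := by exact_mod_cast Nat.lt_two_pow_self (n := i)
  have h3 : ((i : ℝ) + 1) * (i + 1) ≤ 2 ^ (2 * i) := by
    rw [two_mul, pow_add]
    exact mul_le_mul h2 h2 (by positivity) (by positivity)
  push_cast at h1
  have h4 : (2 : ℝ) ^ (2 * i) ≤ lam * (a 1 + c + |B| * (2 * i)) := by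
    have : 1 / lam * (2 : ℝ) ^ (2 * i) ≤ a 1 + c + |B| * (2 * i) := by linarith
    rwa [one_div, inv_mul_le_iff₀ hlam0] at this
  have h5 : lam * (a 1 + c + |B| * (2 * i)) ≤ lam * (|a 1| + |c| + 2 * |B|) * (i + 1) := by
    rw [mul_assoc]
    refine mul_le_mul_of_nonneg_left ?_ hlam0.le
    have hi0 : (0 : ℝ) ≤ i := i.cast_nonneg
    nlinarith [le_abs_self (a 1), le_abs_self c, abs_nonneg (a 1), abs_nonneg c, abs_nonneg B,
      mul_nonneg (abs_nonneg (a 1)) hi0, mul_nonneg (abs_nonneg c) hi0]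
  nlinarith [i.cast_nonneg (α := ℝ)]

/-- Acylindricity of the image implies that only finitely many isometries in the image move the
points of a coarse axis by a given bounded amount. -/
theorem finite_image_toPermHom {C s : ℝ} {p : ℤ → X} (hp : IsCoarseAxis p C s) {K : Set G}
    (hK : ∀ g ∈ K, ∀ x : X, g • x = x) (hK1 : 1 ∈ K) {r R : ℝ}
    (hR : ∀ a b : X, R ≤ dist a b →
      {S : Set G | ∃ g : G, dist (g • a) a ≤ r ∧ dist (g • b) b ≤ r ∧
        S = (fun x => g * x) '' K}.Finite) :
    (MulAction.toPermHom G X '' {y : G | ∀ m, dist (y • p m) (p m) ≤ r}).Finite := by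
  classical
  obtain ⟨M, hM⟩ := exists_nat_gt R
  have hfar : R ≤ dist (p 0) (p M) := by
    have := hp.lower 0 M
    norm_num at this
    linarith
  refine ((hR _ _ hfar).image fun S =>
    if h : S.Nonempty then MulAction.toPermHom G X h.some else 1).subset ?_
  rintro _ ⟨y, hy, rfl⟩
  have hne : ((fun x => y * x) '' K).Nonempty := ⟨_, Set.mem_image_of_mem _ hK1⟩
  refine ⟨_, ⟨y, hy 0, hy M, rfl⟩, ?_⟩
  simp only [dif_pos hne]
  obtain ⟨b, hb, hb'⟩ := hne.some_mem
  rw [← hb']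
  ext x
  simp [mul_smul, hK b hb]

theorem exists_dist_le_of_hausdorffEDist_ne_top {A B : Set X}
    (h : Metric.hausdorffEDist A B ≠ ⊤) : ∃ r, ∀ a ∈ A, ∃ b ∈ B, dist a b ≤ r := by
  obtain ⟨r, hr⟩ := ENNReal.lt_iff_exists_nnreal_btwn.1 h.lt_top
  refine ⟨r, fun a ha => ?_⟩
  obtain ⟨b, hb, hab⟩ := Metric.exists_edist_lt_of_hausdorffEDist_lt ha hr.1
  refine ⟨b, hb, ?_⟩
  rw [edist_nndist, ENNReal.coe_lt_coe] at hab
  exact_mod_cast hab.le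

variable [IsIsometricSMul G X]

theorem dist_zpow_smul_zpow_smul (γ : G) (o : X) (i j : ℤ) :
    dist (γ ^ i • o) (γ ^ j • o) = dist o (γ ^ (j - i) • o) := by
  rw [← dist_smul (γ ^ i) o, smul_smul, ← zpow_add, add_sub_cancel]

/-- Some power of a loxodromic isometry of a hyperbolic space has a coarse axis as orbit. -/
theorem exists_isCoarseAxis_pow {Q : ℝ} (hQ : 0 ≤ Q) (hX : IsFourPointHyperbolic X Q)
    {h : G} {o : X} {lam c : ℝ} (hlam : 1 ≤ lam) (hc : 0 ≤ c)
    (hqi : ∀ m n : ℤ, (1 / lam) * |(m : ℝ) - n| - c ≤ dist ((h ^ m) • o) ((h ^ n) • o) ∧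
      dist ((h ^ m) • o) ((h ^ n) • o) ≤ lam * |(m : ℝ) - n| + c) :
    ∃ N, 0 < N ∧ ∃ C s, IsCoarseAxis (fun i : ℤ => (h ^ N) ^ i • o) C s := by
  obtain ⟨N, hN, hjump⟩ := exists_pos_add_le_double (a := fun n : ℕ => dist o (h ^ n • o)) (c := c)
    hlam (fun n => by simpa using (hqi 0 n).1) (2 * Q + 1)
  refine ⟨N, hN, _, lam * N + c, isCoarseAxis_of_homogeneous hQ hX
    (a := fun n : ℕ => dist o ((h ^ N) ^ n • o)) (fun i n => ?_) ?_ fun i j => ?_⟩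
  · rw [dist_zpow_smul_zpow_smul, add_sub_cancel_left, zpow_natCast]
  · simp only [pow_one, ← pow_mul]
    rw [mul_comm N 2]
    linarith
  · have h1 := (hqi (N * i) (N * j)).2
    rw [zpow_mul, zpow_mul, zpow_natCast] at h1
    push_cast at h1
    rw [← mul_sub, abs_mul, Nat.abs_cast] at h1
    have h2 : 0 ≤ lam * N := by positivity
    nlinarith [abs_nonneg ((i : ℝ) - j)]

/-- The elements of `G` moving the points of a sequence by a bounded amount. -/
def boundedDisplacement (G : Type*) [Group G] [MulAction G X] [IsIsometricSMul G X]
    (p : ℤ → X) : Subgroup G where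
  carrier := {x | ∃ R, ∀ m, dist (x • p m) (p m) ≤ R}
  one_mem' := ⟨0, by simp⟩
  mul_mem' := by
    rintro x y ⟨R, hR⟩ ⟨S, hS⟩
    refine ⟨S + R, fun m => ?_⟩
    have := dist_triangle ((x * y) • p m) (x • p m) (p m)
    rw [mul_smul, dist_smul] at this
    rw [mul_smul]
    linarith [hR m, hS m]
  inv_mem' := by
    rintro x ⟨R, hR⟩
    refine ⟨R, fun m => ?_⟩
    rw [← dist_smul x, smul_inv_smul, dist_comm]
    exact hR m

/-- Elements moving a coarse axis by a bounded amount can be translated along the axis so as to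
move it by a uniformly bounded amount. -/
theorem exists_translate_dist_le {Q C s : ℝ} (hQ : 0 ≤ Q) (hX : IsFourPointHyperbolic X Q)
    {γ : G} {o : X} (hp : IsCoarseAxis (fun i : ℤ => γ ^ i • o) C s) :
    ∃ r, 0 ≤ r ∧ ∀ x ∈ boundedDisplacement G (fun i : ℤ => γ ^ i • o),
      ∃ i : ℤ, ∀ m : ℤ, dist ((γ ^ i * x) • γ ^ m • o) (γ ^ m • o) ≤ r := by
  set p : ℤ → X := fun i => γ ^ i • o with hpdef
  have hC := hp.nonneg_detour
  have hs : 0 ≤ s := by simpa using hp.upper 0 0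
  refine ⟨3 * (2 * C + 2 * Q + 2 * s) + 2 * C + Q, by positivity, fun x hx => ?_⟩
  have hnear : ∀ y ∈ boundedDisplacement G p, ∀ m,
      ∃ j, dist (y • p m) (p j) ≤ 2 * C + 2 * Q + 2 * s := by
    rintro y ⟨R, hR⟩ m
    exact hp.exists_dist_le hX hQ (q := fun m => y • p m) (fun i j => dist_smul _ _ _) hR m
  obtain ⟨i, hi⟩ := hnear x hx 0
  have hγ : γ ∈ boundedDisplacement G p := by
    refine ⟨dist (γ • o) o, fun m => le_of_eq ?_⟩
    rw [hpdef]
    dsimp only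
    rw [smul_smul, ← zpow_one_add, add_comm, zpow_add_one, mul_smul, dist_smul]
  have hy := mul_mem (zpow_mem hγ (-i)) hx
  refine ⟨-i, fun m => ?_⟩
  obtain ⟨R, hR⟩ := id hy
  refine hp.dist_le_of_fellow_travel hX hQ (q := fun m => (γ ^ (-i) * x) • p m)
    (fun i j => dist_smul _ _ _) hR (hnear _ hy) ?_ m
  rw [mul_smul, ← dist_smul (γ ^ i), smul_smul, zpow_neg, mul_inv_cancel, one_smul]
  simpa [hpdef] using hi

/-- Every point of an orbit of `h` is close to the orbit of `h ^ N`. -/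
theorem exists_dist_zpow_pow_le {h : G} {o : X} {N : ℕ} (hN : 0 < N) :
    ∃ D, ∀ j : ℤ, dist (h ^ j • o) ((h ^ N) ^ (j / N) • o) ≤ D := by
  obtain ⟨D, hD⟩ := ((Set.finite_Ico (0 : ℤ) N).image fun i => dist (h ^ i • o) o).bddAbove
  refine ⟨D, fun j => ?_⟩
  have h1 : h ^ j = (h ^ N) ^ (j / N) * h ^ (j % N) := by
    rw [← zpow_natCast, ← zpow_mul, ← zpow_add, Int.mul_ediv_add_emod]
  have hN' : (0 : ℤ) < N := by exact_mod_cast hN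
  rw [h1, mul_smul, dist_smul]
  exact hD ⟨_, ⟨Int.emod_nonneg _ hN'.ne', Int.emod_lt_of_pos _ hN'⟩, rfl⟩

/-- An element commuting with a power of `h` moves the orbit of `h` to a finite Hausdorff
distance. -/
theorem hausdorffEDist_smul_orbit_ne_top {h x : G} {o : X} {k : ℕ} (hk : 0 < k)
    (hx : x * h ^ k = h ^ k * x) :
    Metric.hausdorffEDist (x • {p : X | ∃ n : ℤ, p = h ^ n • o})
      {p : X | ∃ n : ℤ, p = h ^ n • o} ≠ ⊤ := by
  obtain ⟨D, hD⟩ := exists_dist_zpow_pow_le (h := h) (o := o) hk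
  have hbound : ∀ n : ℤ, edist (x • h ^ n • o) (h ^ n • o) ≤
      ENNReal.ofReal (D + dist (x • o) o + D) := by
    intro n
    rw [edist_dist]
    refine ENNReal.ofReal_le_ofReal ?_
    have h1 : dist (x • (h ^ k) ^ (n / k) • o) ((h ^ k) ^ (n / k) • o) = dist (x • o) o := by
      have : x * (h ^ k) ^ (n / k) = (h ^ k) ^ (n / k) * x := Commute.zpow_right hx _
      rw [smul_smul, this, mul_smul, dist_smul]
    have h2 := dist_triangle4 (x • h ^ n • o) (x • (h ^ k) ^ (n / k) • o)
      ((h ^ k) ^ (n / k) • o) (h ^ n • o)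
    rw [h1, dist_smul, dist_comm ((h ^ k) ^ (n / (k : ℤ)) • o)] at h2
    linarith [hD n]
  refine ne_top_of_le_ne_top ENNReal.ofReal_ne_top (Metric.hausdorffEDist_le_of_mem_edist
    (r := ENNReal.ofReal (D + dist (x • o) o + D)) ?_ ?_)
  · rintro _ ⟨_, ⟨n, rfl⟩, rfl⟩
    exact ⟨_, ⟨n, rfl⟩, hbound n⟩
  · rintro _ ⟨n, rfl⟩
    refine ⟨_, Set.smul_mem_smul_set ⟨n, rfl⟩, ?_⟩
    rw [edist_comm]
    exact hbound n

/-- An element moving the orbit of `h` to a finite Hausdorff distance either moves the orbit of a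
power of `h` by a bounded amount, or does so up to reversing the orbit. -/
theorem mem_boundedDisplacement_or_reverse {h x : G} {o : X} {N : ℕ} (hN : 0 < N) {C s : ℝ}
    (hp : IsCoarseAxis (fun i : ℤ => (h ^ N) ^ i • o) C s)
    (hx : Metric.hausdorffEDist (x • {p : X | ∃ n : ℤ, p = h ^ n • o})
      {p : X | ∃ n : ℤ, p = h ^ n • o} ≠ ⊤) :
    x ∈ boundedDisplacement G (fun i : ℤ => (h ^ N) ^ i • o) ∨
      ∃ R, ∀ m : ℤ, dist (x • (h ^ N) ^ m • o) ((h ^ N) ^ (-m) • o) ≤ R := by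
  obtain ⟨r, hr⟩ := exists_dist_le_of_hausdorffEDist_ne_top hx
  obtain ⟨D, hD⟩ := exists_dist_zpow_pow_le (h := h) (o := o) hN
  refine hp.fellow_travel_or_reverse (q := fun i => x • (h ^ N) ^ i • o) (fun m => ?_)
    (fun i j => dist_smul _ _ _) (r := r + D) fun m => ?_
  · rw [dist_zpow_smul_zpow_smul, dist_comm ((h ^ N) ^ m • o), dist_zpow_smul_zpow_smul]
    simp
  · obtain ⟨_, ⟨j, rfl⟩, hj⟩ := hr (x • (h ^ N) ^ m • o)
      (Set.smul_mem_smul_set ⟨N * m, by rw [zpow_mul, zpow_natCast]⟩)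
    exact ⟨j / N, (dist_triangle _ _ _).trans (add_le_add hj (hD j))⟩

end Action

theorem elementary_closure_virtually_centralizer
    {δ : ℝ} (hδ : 0 ≤ δ) (X : Type*) [MetricSpace X]
    (hgeo : IsGeodesicSpace X) (hhyp : IsDeltaHyperbolic X δ)
    (G : Type*) [Group G] [MulAction G X]
    (hiso : ∀ g : G, Isometry (fun x : X => g • x))
    (H K : Subgroup G)
    -- (i) G is generated by H ∪ K
    (hgen : Subgroup.closure ((H : Set G) ∪ (K : Set G)) = ⊤)
    -- (ii) every element of H commutes with every element of K
    (hcomm : ∀ a ∈ H, ∀ b ∈ K, a * b = b * a)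
    -- (iii) K is the kernel of the action
    (hker : (K : Set G) = {g : G | ∀ x : X, g • x = x})
    -- (iv) the action has acylindrical image
    (hacyl : ∀ r : ℝ, 0 ≤ r → ∃ R N : ℝ, 0 ≤ R ∧ 0 ≤ N ∧
      ∀ a b : X, R ≤ dist a b →
        {S : Set G | ∃ g : G, dist (g • a) a ≤ r ∧ dist (g • b) b ≤ r ∧
            S = (fun x => g * x) '' (K : Set G)}.Finite ∧
        (({S : Set G | ∃ g : G, dist (g • a) a ≤ r ∧ dist (g • b) b ≤ r ∧
            S = (fun x => g * x) '' (K : Set G)}.ncard : ℝ) ≤ N))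
    (h : G) (hh : h ∈ H) (o : X)
    -- h is loxodromic with quasi-geodesic orbit n ↦ hⁿ • o
    (hlox : ∃ lam c : ℝ, 1 ≤ lam ∧ 0 ≤ c ∧ ∀ m n : ℤ,
      (1 / lam) * |(m : ℝ) - n| - c ≤ dist ((h ^ m) • o) ((h ^ n) • o) ∧
      dist ((h ^ m) • o) ((h ^ n) • o) ≤ lam * |(m : ℝ) - n| + c) :
    ∃ k : ℕ, 0 < k ∧ ∃ t : G,
      ({x : G | x * h ^ k = h ^ k * x} ⊆
        {x : G | EMetric.hausdorffEdist
          (x • {p : X | ∃ n : ℤ, p = (h ^ n) • o}) {p : X | ∃ n : ℤ, p = (h ^ n) • o} ≠ ⊤}) ∧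
      ({x : G | EMetric.hausdorffEdist
          (x • {p : X | ∃ n : ℤ, p = (h ^ n) • o}) {p : X | ∃ n : ℤ, p = (h ^ n) • o} ≠ ⊤} ⊆
        {x : G | x * h ^ k = h ^ k * x} ∪
          (fun x => t * x) '' {x : G | x * h ^ k = h ^ k * x}) := by
  have : IsIsometricSMul G X := ⟨hiso⟩
  have hQ : 0 ≤ 6 * δ := by positivity
  have hX := hhyp.isFourPointHyperbolic hgeo
  obtain ⟨lam, c, hlam, hc, hqi⟩ := hlox
  obtain ⟨N, hN, C, s, hp⟩ := exists_isCoarseAxis_pow hQ hX hlam hc hqi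
  obtain ⟨r, hr0, hr⟩ := exists_translate_dist_le hQ hX hp
  obtain ⟨R, _, _, _, hR⟩ := hacyl r hr0
  have hK : ∀ g : G, g ∈ K ↔ ∀ x : X, g • x = x := fun g => Set.ext_iff.1 hker g
  have hfin := finite_image_toPermHom hp (fun g hg => (hK g).1 hg) K.one_mem
    fun a b hab => (hR a b hab).1
  have hKφ : (MulAction.toPermHom G X).ker = K := by
    ext g
    simp [MonoidHom.mem_ker, hK, Equiv.ext_iff]
  have hconj : ∀ y ∈ {y : G | ∀ m : ℤ, dist (y • (h ^ N) ^ m • o) ((h ^ N) ^ m • o) ≤ r},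
      (h ^ N)⁻¹ * y * h ^ N ∈
        {y : G | ∀ m : ℤ, dist (y • (h ^ N) ^ m • o) ((h ^ N) ^ m • o) ≤ r} := by
    intro y hy m
    have := hy (1 + m)
    rw [zpow_add, zpow_one] at this
    rw [← dist_smul (h ^ N)]
    simpa [smul_smul, mul_assoc] using this
  obtain ⟨n, hn, hcent⟩ := exists_pow_commute (MulAction.toPermHom G X) (H := H)
    (by rwa [hKφ]) (by rwa [hKφ]) (H.pow_mem hh N) hfin hconj hr
  simp only [← pow_mul] at hcent
  have hk : 0 < N * n := Nat.mul_pos hN hn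
  have hsub : {x : G | x * h ^ (N * n) = h ^ (N * n) * x} ⊆ {x : G | Metric.hausdorffEDist
      (x • {p : X | ∃ n : ℤ, p = (h ^ n) • o}) {p : X | ∃ n : ℤ, p = (h ^ n) • o} ≠ ⊤} :=
    fun x hx => hausdorffEDist_smul_orbit_ne_top hk hx
  by_cases hrev : ∃ t : G, ∃ R, ∀ m : ℤ,
      dist (t • (h ^ N) ^ m • o) ((h ^ N) ^ (-m) • o) ≤ R
  · obtain ⟨t, R, ht⟩ := hrev
    refine ⟨N * n, hk, t, hsub, fun x hx => ?_⟩
    rcases mem_boundedDisplacement_or_reverse hN hp hx with hx | ⟨S, hS⟩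
    · exact .inl (hcent x hx)
    · refine .inr ⟨t⁻¹ * x, hcent _ ⟨S + R, fun m => ?_⟩, mul_inv_cancel_left t x⟩
      rw [← dist_smul t, smul_smul, mul_inv_cancel_left]
      exact (dist_triangle_right _ _ _).trans (add_le_add (hS m) (ht m))
  · refine ⟨N * n, hk, 1, hsub, fun x hx => .inl (hcent x ?_)⟩
    exact (mem_boundedDisplacement_or_reverse hN hp hx).resolve_right fun h => hrev ⟨x, h⟩
end

section
/- Let G be a group and let H ≤ K ≤ G be subgroups such that H has finite index in K. If H is separable in G, then K is separable in G. -/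
/-- A subgroup `H` of `G` is separable if it equals the intersection of all
finite-index subgroups of `G` containing it. -/
def IsSeparableSubgroup {G : Type*} [Group G] (H : Subgroup G) : Prop :=
  (H : Set G) = ⋂ K ∈ {K : Subgroup G | H ≤ K ∧ K.FiniteIndex}, (K : Set G)

theorem separable_of_finiteIndex_supergroup
    {G : Type*} [Group G] (H K : Subgroup G) (hHK : H ≤ K)
    (hfi : (H.subgroupOf K).FiniteIndex)
    (hsep : IsSeparableSubgroup H) :
    IsSeparableSubgroup K := by
  have mem_of_forall_mem : ∀ g : G,
      (∀ L : Subgroup G, H ≤ L → L.FiniteIndex → g ∈ L) → g ∈ H := by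
    intro g hg
    rw [← SetLike.mem_coe, show (H : Set G) = _ from hsep]
    exact Set.mem_iInter₂.2 fun L hL => hg L hL.1 hL.2
  refine Set.Subset.antisymm (Set.subset_iInter₂ fun L hL => hL.1) fun g hg => ?_
  by_contra hgK
  have exists_avoiding (q : K ⧸ H.subgroupOf K) :
      ∃ L : Subgroup G, H ≤ L ∧ L.FiniteIndex ∧ (q.out : G)⁻¹ * g ∉ L := by
    by_contra! hq
    refine hgK ?_
    simpa using K.mul_mem q.out.2 (hHK (mem_of_forall_mem _ hq))
  choose L hHL hL hgL using exists_avoiding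
  have hfinite : (⨅ q, L q).FiniteIndex := Subgroup.finiteIndex_iInf hL
  have hsup : (K ⊔ (⨅ q, L q).normalCore).FiniteIndex :=
    Subgroup.finiteIndex_of_le (le_sup_right : (⨅ q, L q).normalCore ≤ _)
  obtain ⟨k, hk, n, hn, rfl⟩ :=
    Subgroup.mem_sup_of_normal_right.1 (Set.mem_iInter₂.1 hg _ ⟨le_sup_left, hsup⟩)
  let q : K ⧸ H.subgroupOf K := QuotientGroup.mk ⟨k, hk⟩
  have hout : (q.out : G)⁻¹ * k ∈ H :=
    Subgroup.mem_subgroupOf.1 (QuotientGroup.eq.1 q.out_eq')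
  have hnL : n ∈ L q := iInf_le L q (Subgroup.normalCore_le _ hn)
  apply hgL q
  rw [← mul_assoc]
  exact (L q).mul_mem (hHL q hout) hnL
end

section
/- Let G be a residually finite group, g ∈ G, k a positive integer, and E a subgroup of G containing the centralizer C_G(g^k) = {x ∈ G : x g^k = g^k x} such that C_G(g^k) has finite index in E. Then E is separable in G. -/
/-- A group is residually finite if every nontrivial element avoids some
finite-index subgroup. -/
def ResiduallyFinite (G : Type*) [Group G] : Prop :=
  ∀ g : G, g ≠ 1 → ∃ K : Subgroup G, K.FiniteIndex ∧ g ∉ K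

theorem isSeparableSubgroup_iff {G : Type*} [Group G] {H : Subgroup G} :
    IsSeparableSubgroup H ↔
      ∀ x ∉ H, ∃ K : Subgroup G, H ≤ K ∧ K.FiniteIndex ∧ x ∉ K := by
  constructor
  · intro h x hx
    have hx' : x ∉ (H : Set G) := hx
    rw [h] at hx'
    simpa [and_assoc] using hx'
  · intro h
    apply Set.Subset.antisymm
    · exact Set.subset_iInter₂ fun K hK => hK.1
    · intro x hx
      by_contra hxH
      obtain ⟨K, hHK, hK, hxK⟩ := h x hxH
      exact hxK (Set.mem_iInter₂.1 hx K ⟨hHK, hK⟩)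

theorem ResiduallyFinite.isSeparableSubgroup_centralizer_singleton {G : Type*} [Group G]
    (hG : ResiduallyFinite G) (a : G) : IsSeparableSubgroup (Subgroup.centralizer {a}) := by
  refine isSeparableSubgroup_iff.2 fun x hx => ?_
  have hne : x * a * x⁻¹ * a⁻¹ ≠ 1 := fun h =>
    hx (Subgroup.mem_centralizer_singleton_iff.2
      (mul_inv_eq_iff_eq_mul.1 (mul_inv_eq_one.1 h)))
  obtain ⟨K, hK, hxK⟩ := hG _ hne
  refine ⟨Subgroup.centralizer {a} ⊔ K.normalCore, le_sup_left,
    Subgroup.finiteIndex_of_le le_sup_right, fun hmem => ?_⟩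
  obtain ⟨c, hc, n, hn, rfl⟩ := Subgroup.mem_sup_of_normal_right.1 hmem
  have hca : c⁻¹ * a⁻¹ = a⁻¹ * c⁻¹ := by
    rw [← mul_inv_rev, ← mul_inv_rev, Subgroup.mem_centralizer_singleton_iff.1 hc]
  have heq : c * n * a * (c * n)⁻¹ * a⁻¹ = c * (n * (a * n⁻¹ * a⁻¹)) * c⁻¹ := by
    simp only [mul_inv_rev, mul_assoc, hca]
  apply hxK
  rw [heq]
  have hnormal : K.normalCore.Normal := inferInstance
  exact K.normalCore_le
    (hnormal.conj_mem _ (mul_mem hn (hnormal.conj_mem _ (inv_mem hn) a)) c)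

theorem IsSeparableSubgroup.of_le_of_finiteIndex {G : Type*} [Group G] {H E : Subgroup G}
    (hH : IsSeparableSubgroup H) (hHE : H ≤ E) (hfi : (H.subgroupOf E).FiniteIndex) :
    IsSeparableSubgroup E := by
  refine isSeparableSubgroup_iff.2 fun x hx => ?_
  have hsep (q : E ⧸ H.subgroupOf E) :
      ∃ K : Subgroup G, H ≤ K ∧ K.FiniteIndex ∧ (q.out : G)⁻¹ * x ∉ K := by
    refine isSeparableSubgroup_iff.1 hH _ fun hmem => hx ?_
    simpa using mul_mem q.out.2 (hHE hmem)
  choose K hHK hK hxK using hsep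
  have hinf : (⨅ q, K q).FiniteIndex := Subgroup.finiteIndex_iInf hK
  refine ⟨E ⊔ (⨅ q, K q).normalCore, le_sup_left,
    Subgroup.finiteIndex_of_le le_sup_right, fun hmem => ?_⟩
  obtain ⟨e, he, n, hn, rfl⟩ := Subgroup.mem_sup_of_normal_right.1 hmem
  let q : E ⧸ H.subgroupOf E := QuotientGroup.mk ⟨e, he⟩
  have hq : (q.out : G)⁻¹ * e ∈ H :=
    Subgroup.mem_subgroupOf.1 (QuotientGroup.eq.1 (QuotientGroup.out_eq' q))
  apply hxK q
  rw [← mul_assoc]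
  exact mul_mem (hHK q hq) (Subgroup.mem_iInf.1 (Subgroup.normalCore_le _ hn) q)

theorem virtual_centralizer_separable_of_residually_finite
    {G : Type*} [Group G] (hRF : ResiduallyFinite G)
    (g : G) (k : ℕ) (hk : 0 < k)
    (C E : Subgroup G) (hC : (C : Set G) = {x : G | x * g ^ k = g ^ k * x})
    (hCE : C ≤ E) (hfi : (C.subgroupOf E).FiniteIndex) :
    IsSeparableSubgroup E := by
  have hcent : C = Subgroup.centralizer {g ^ k} := by
    ext x
    rw [← SetLike.mem_coe, hC, Subgroup.mem_centralizer_singleton_iff]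
    rfl
  subst hcent
  exact (hRF.isSeparableSubgroup_centralizer_singleton (g ^ k)).of_le_of_finiteIndex hCE hfi
end

section
/- For every ξ ≥ 0 there exist ξ' ≥ 0 and ε ≥ 0, depending only on ξ, such that the following holds. Let (Y_i)_{i∈I} together with subsets (π_i(j))_{i≠j} be a projection system with constant ξ. Then there exist nonempty bounded subsets π'_i(j) ⊆ Y_i for all i ≠ j such that the Hausdorff distance between π_i(j) and π'_i(j) is at most ε for all i ≠ j, and, writing d'_i(j,k) = diam(π'_i(j) ∪ π'_i(k)), the family (π'_i(j)) satisfies the strong projection axioms with constant ξ': (P0) diam π'_i(j) ≤ ξ' for all i ≠ j; (P1') for pairwise distinct i, j, k, if d'_j(i,k) > ξ' then π'_i(j) = π'_i(k); (P2) for all i ≠ k, the set {j : d'_j(i,k) > ξ'} is finite. -/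
/-- The projection axioms with constant `ξ` for a family of metric spaces
`Y i` with nonempty bounded projection sets `π i j ⊆ Y i` for `i ≠ j`. -/
def ProjectionSystem {I : Type*} (Y : I → Type*) [∀ i, MetricSpace (Y i)]
    (π : ∀ i : I, I → Set (Y i)) (ξ : ℝ) : Prop :=
  (∀ i j, i ≠ j → (π i j).Nonempty ∧ Bornology.IsBounded (π i j)) ∧
  -- (P0) bounded projections
  (∀ i j, i ≠ j → Metric.diam (π i j) ≤ ξ) ∧
  -- (P1) Behrstock inequality
  (∀ i j k : I, i ≠ j → j ≠ k → i ≠ k →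
    Metric.diam (π j i ∪ π j k) > ξ → Metric.diam (π i j ∪ π i k) ≤ ξ) ∧
  -- (P2) finiteness
  (∀ i k : I, i ≠ k → {j : I | j ≠ i ∧ j ≠ k ∧ Metric.diam (π j i ∪ π j k) > ξ}.Finite)

/-- The strong projection axioms with constant `ξ`. -/
def StrongProjectionSystem {I : Type*} (Y : I → Type*) [∀ i, MetricSpace (Y i)]
    (π : ∀ i : I, I → Set (Y i)) (ξ : ℝ) : Prop :=
  (∀ i j, i ≠ j → (π i j).Nonempty ∧ Bornology.IsBounded (π i j)) ∧
  -- (P0) bounded projections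
  (∀ i j, i ≠ j → Metric.diam (π i j) ≤ ξ) ∧
  -- (P1') strong Behrstock inequality
  (∀ i j k : I, i ≠ j → j ≠ k → i ≠ k →
    Metric.diam (π j i ∪ π j k) > ξ → π i j = π i k) ∧
  -- (P2) finiteness
  (∀ i k : I, i ≠ k → {j : I | j ≠ i ∧ j ≠ k ∧ Metric.diam (π j i ∪ π j k) > ξ}.Finite)

/-- The combinatorial properties of `d j a b = diam (π j a ∪ π j b)` for a family of projections
satisfying the projection axioms. -/
structure IsProjectionDist {I : Type*} (d : I → I → I → ℝ) (ξ : ℝ) : Prop where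
  nonneg : 0 ≤ ξ
  symm : ∀ j a b, d j a b = d j b a
  self_le : ∀ j a, a ≠ j → d j a a ≤ ξ
  triangle : ∀ j a b c, a ≠ j → b ≠ j → c ≠ j → d j a c ≤ d j a b + d j b c
  behrstock : ∀ i j k, i ≠ j → j ≠ k → i ≠ k → ξ < d j i k → d i j k ≤ ξ

/-- Seen from `i`, the index `j` equals `k` or lies between `i` and `k`, with threshold `c`. -/
def Precedes {I : Type*} (d : I → I → I → ℝ) (i : I) (c : ℝ) (j k : I) : Prop :=
  j = k ∨ (j ≠ k ∧ c < d j i k)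

/-- The graph on the indices different from `i` joining two indices if one of them lies between
`i` and the other, with threshold `c`. -/
def betweennessGraph {I : Type*} (d : I → I → I → ℝ) (i : I) (c : ℝ) : SimpleGraph I where
  Adj j k := j ≠ i ∧ k ≠ i ∧ j ≠ k ∧ (c < d j i k ∨ c < d k i j)
  symm := ⟨fun _ _ h => ⟨h.2.1, h.1, h.2.2.1.symm, h.2.2.2.symm⟩⟩
  loopless := ⟨fun _ h => h.2.2.1 rfl⟩

section Precedes

variable {I : Type*} {d : I → I → I → ℝ} {ξ : ℝ} {i : I}

theorem Precedes.mono {a b : ℝ} {j k : I} (h : Precedes d i a j k) (hab : b ≤ a) :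
    Precedes d i b j k :=
  h.imp_right fun h => ⟨h.1, hab.trans_lt h.2⟩

theorem Precedes.eq_of_symm (hd : IsProjectionDist d ξ) {a b : ℝ} {j k : I} (hj : j ≠ i)
    (hk : k ≠ i) (ha : ξ ≤ a) (hb : ξ ≤ b) (h : Precedes d i a j k) (h' : Precedes d i b k j) :
    j = k := by
  rcases h with h | ⟨hne, h⟩
  · exact h
  rcases h' with h' | ⟨-, h'⟩
  · exact h'.symm
  have := hd.behrstock k j i hne.symm hj hk (by rw [hd.symm]; linarith)
  rw [hd.symm] at this
  linarith

theorem Precedes.trans (hd : IsProjectionDist d ξ) {a b c : ℝ} {j k l : I} (hj : j ≠ i)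
    (hk : k ≠ i) (hl : l ≠ i) (ha : ξ ≤ a) (hb : 2 * ξ ≤ b) (hca : c ≤ a - ξ) (hcb : c ≤ b)
    (h : Precedes d i a j k) (h' : Precedes d i b k l) : Precedes d i c j l := by
  have h0 := hd.nonneg
  rcases h with rfl | ⟨hjk, h⟩
  · exact h'.mono hcb
  rcases h' with rfl | ⟨hkl, h'⟩
  · exact Or.inr ⟨hjk, by linarith⟩
  have h1 : d k j i ≤ ξ :=
    hd.behrstock k j i hjk.symm hj hk (by rw [hd.symm]; linarith)
  rw [hd.symm] at h1
  have hjl : j ≠ l := by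
    rintro rfl
    linarith
  have h2 := hd.triangle k i j l hk.symm hjk hkl.symm
  have h3 := hd.behrstock j k l hjk hkl hjl (by linarith)
  rw [hd.symm] at h3
  have h4 := hd.triangle j i l k hj.symm hjl.symm hjk.symm
  exact Or.inr ⟨hjl, by linarith⟩

theorem Precedes.comparable (hd : IsProjectionDist d ξ) {a b : ℝ} {j k l : I} (hj : j ≠ i)
    (hk : k ≠ i) (ha : 2 * ξ ≤ a) (hb : 2 * ξ ≤ b)
    (h : Precedes d i a j l) (h' : Precedes d i b k l) :
    Precedes d i (a - ξ) j k ∨ Precedes d i (b - ξ) k j := by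
  have h0 := hd.nonneg
  rcases h with rfl | ⟨hjl, h⟩
  · exact Or.inr (h'.mono (by linarith))
  rcases h' with rfl | ⟨hkl, h'⟩
  · exact Or.inl (Or.inr ⟨hjl, by linarith⟩)
  by_cases hjk : j = k
  · exact Or.inl (Or.inl hjk)
  have hkj : k ≠ j := Ne.symm hjk
  have tj := hd.triangle j i k l hj.symm hkj hjl.symm
  have tk := hd.triangle k i j l hk.symm hjk hkl.symm
  have sj := hd.triangle j i l k hj.symm hjl.symm hkj
  have sk := hd.triangle k i l j hk.symm hkl.symm hjk
  rw [hd.symm j l k] at sj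
  rw [hd.symm k l j] at sk
  by_cases hlt : ξ < d j i k
  · have h1 := hd.behrstock k j i hkj hj hk (by rwa [hd.symm])
    rw [hd.symm] at h1
    have h2 := hd.behrstock j k l hjk hkl hjl (by linarith)
    exact Or.inl (Or.inr ⟨hjk, by linarith⟩)
  · have h2 := hd.behrstock k j l hkj hjl hkl (by linarith)
    exact Or.inr (Or.inr ⟨hkj, by linarith⟩)

theorem Precedes.dist_le (hd : IsProjectionDist d ξ) {a : ℝ} {j k : I} (hj : j ≠ i)
    (hk : k ≠ i) (ha : ξ ≤ a) (h : Precedes d i a j k) : d i j k ≤ ξ := by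
  rcases h with rfl | ⟨hjk, h⟩
  · exact hd.self_le i j hj
  · exact hd.behrstock i j k hj.symm hjk hk.symm (by linarith)

/-- An index preceding every index of a path as well as, on one side of the path, its neighbour `q`
with a large threshold, precedes the whole of that side with a threshold independent of the
length of the path. -/
theorem Precedes.improve (hd : IsProjectionDist d ξ) {m m' q t : I} (hm : m ≠ i) (hm' : m' ≠ i)
    (hq : q ≠ i) (ht : t ≠ i) (hmm' : Precedes d i (2 * ξ) m m')
    (hmq : Precedes d i (2 * ξ) m q)
    (hadj : Precedes d i (6 * ξ) m q ∨ Precedes d i (6 * ξ) q m)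
    (hm'q : Precedes d i (3 * ξ) m' q) (hm't : Precedes d i (3 * ξ) m' t) :
    Precedes d i (3 * ξ) m t := by
  have h0 := hd.nonneg
  have hmq' : Precedes d i (6 * ξ) m q := by
    rcases hadj with h | h
    · exact h
    · exact Or.inl (hmq.eq_of_symm hd hm hq (by linarith) (by linarith) h)
  have h : Precedes d i (5 * ξ) m m' := by
    rcases hmq'.comparable hd hm hm' (by linarith) (by linarith) hm'q with h | h
    · exact h.mono (by linarith)
    · exact Or.inl (hmm'.eq_of_symm hd hm hm' (by linarith) (by linarith) h)
  exact h.trans hd hm hm' ht (by linarith) (by linarith) (by linarith) le_rfl hm't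

theorem exists_precedes_of_path (hd : IsProjectionDist d ξ) {p : ℕ → I} (hp : ∀ t, p t ≠ i)
    (hadj : ∀ t, Precedes d i (6 * ξ) (p t) (p (t + 1)) ∨
      Precedes d i (6 * ξ) (p (t + 1)) (p t)) (n : ℕ) :
    ∀ a, ∃ s, a ≤ s ∧ s ≤ a + n ∧
      ∀ t, a ≤ t → t ≤ a + n → Precedes d i (3 * ξ) (p s) (p t) := by
  have h0 := hd.nonneg
  induction n using Nat.strong_induction_on with
  | _ n ih =>
  intro a
  rcases n with _ | n
  · exact ⟨a, le_rfl, le_rfl, fun t h1 h2 => Or.inl (by rw [le_antisymm h1 h2])⟩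
  have weak : ∃ s, a ≤ s ∧ s ≤ a + (n + 1) ∧
      ∀ t, a ≤ t → t ≤ a + (n + 1) → Precedes d i (2 * ξ) (p s) (p t) := by
    obtain ⟨s, hs1, hs2, hs⟩ := ih n (Nat.lt_succ_self n) (a + 1)
    have key : Precedes d i (2 * ξ) (p s) (p a) ∨ Precedes d i (5 * ξ) (p a) (p s) := by
      have hsa := hs (a + 1) le_rfl (by omega)
      rcases hadj a with h | h
      · rcases h.comparable hd (hp a) (hp s) (by linarith) (by linarith) hsa with h | h
        · exact Or.inr (h.mono (by linarith))
        · exact Or.inl (h.mono (by linarith))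
      · exact Or.inl (hsa.trans hd (hp _) (hp _) (hp _) (by linarith) (by linarith)
          (by linarith) (by linarith) h)
    rcases key with h | h
    · refine ⟨s, by omega, by omega, fun t h1 h2 => ?_⟩
      rcases h1.eq_or_lt with rfl | h1
      · exact h
      · exact (hs t h1 (by omega)).mono (by linarith)
    · refine ⟨a, le_rfl, by omega, fun t h1 h2 => ?_⟩
      rcases h1.eq_or_lt with rfl | h1
      · exact Or.inl rfl
      · exact h.trans hd (hp _) (hp _) (hp _) (by linarith) (by linarith) (by linarith)
          (by linarith) (hs t h1 (by omega))
  obtain ⟨s, hs1, hs2, hs⟩ := weak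
  refine ⟨s, hs1, hs2, fun t h1 h2 => ?_⟩
  rcases lt_trichotomy t s with hts | rfl | hst
  · obtain ⟨r, rfl⟩ : ∃ r, s = r + 1 := ⟨s - 1, by omega⟩
    obtain ⟨u, hu1, hu2, hu⟩ := ih (r - a) (by omega) a
    exact Precedes.improve hd (hp _) (hp u) (hp r) (hp t) (hs u hu1 (by omega))
      (hs r (by omega) (by omega)) (hadj r).symm (hu r (by omega) (by omega))
      (hu t h1 (by omega))
  · exact Or.inl rfl
  · obtain ⟨u, hu1, hu2, hu⟩ := ih (a + (n + 1) - (s + 1)) (by omega) (s + 1)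
    exact Precedes.improve hd (hp _) (hp u) (hp (s + 1)) (hp t) (hs u (by omega) (by omega))
      (hs (s + 1) (by omega) (by omega)) (hadj s) (hu (s + 1) le_rfl (by omega))
      (hu t hst (by omega))

theorem ne_of_reachable_betweennessGraph {c : ℝ} {j k : I} (hj : j ≠ i)
    (h : (betweennessGraph d i c).Reachable j k) : k ≠ i := by
  obtain ⟨w⟩ := h
  induction w with
  | nil => exact hj
  | cons hadj _ ih => exact ih hadj.2.1

theorem IsProjectionDist.le_of_reachable (hd : IsProjectionDist d ξ) {j k : I} (hj : j ≠ i)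
    (h : (betweennessGraph d i (6 * ξ)).Reachable j k) : d i j k ≤ 2 * ξ := by
  have h0 := hd.nonneg
  have hk := ne_of_reachable_betweennessGraph hj h
  obtain ⟨w⟩ := h
  have hp : ∀ t, w.getVert t ≠ i := fun t =>
    ne_of_reachable_betweennessGraph hj ⟨w.take t⟩
  obtain ⟨s, -, -, hs⟩ := exists_precedes_of_path hd hp (fun t => by
    rcases lt_or_ge t w.length with ht | ht
    · obtain ⟨-, -, hne, h | h⟩ := w.adj_getVert_succ ht
      · exact Or.inl (Or.inr ⟨hne, h⟩)
      · exact Or.inr (Or.inr ⟨hne.symm, h⟩)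
    · exact Or.inl (Or.inl (by
        rw [w.getVert_of_length_le ht, w.getVert_of_length_le (by omega)]))) w.length 0
  have h1 := (hs 0 le_rfl (by omega)).dist_le hd (hp _) (hp _) (by linarith)
  have h2 := (hs w.length (by omega) (by omega)).dist_le hd (hp _) (hp _) (by linarith)
  rw [w.getVert_zero] at h1
  rw [w.getVert_length] at h2
  have h3 := hd.triangle i j (w.getVert s) k hj (hp s) hk
  rw [hd.symm i j (w.getVert s)] at h3
  linarith

end Precedes

theorem ProjectionSystem.isProjectionDist {I : Type*} {Y : I → Type*} [∀ i, MetricSpace (Y i)]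
    {π : ∀ i : I, I → Set (Y i)} {ξ : ℝ} (h0 : 0 ≤ ξ) (h : ProjectionSystem Y π ξ) :
    IsProjectionDist (fun j a b => Metric.diam (π j a ∪ π j b)) ξ where
  nonneg := h0
  symm j a b := by rw [Set.union_comm]
  self_le j a ha := by
    rw [Set.union_self]
    exact h.2.1 j a ha.symm
  triangle j a b c ha hb hc := by
    obtain ⟨⟨x, hx⟩, hbb⟩ := h.1 j b hb.symm
    have hba := (h.1 j a ha.symm).2
    have hbc := (h.1 j c hc.symm).2
    refine (Metric.diam_mono (Set.union_subset_union Set.subset_union_left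
      Set.subset_union_right) ((hba.union hbb).union (hbb.union hbc))).trans ?_
    exact Metric.diam_union' ⟨x, Or.inr hx, Or.inl hx⟩
  behrstock i j k hij hjk hik := h.2.2.1 i j k hij hjk hik

theorem strong_projection_axioms_from_projection_axioms :
    ∀ ξ : ℝ, 0 ≤ ξ → ∃ ξ' ε : ℝ, 0 ≤ ξ' ∧ 0 ≤ ε ∧
      ∀ (I : Type*) (Y : I → Type*) [∀ i, MetricSpace (Y i)]
        (π : ∀ i : I, I → Set (Y i)),
        ProjectionSystem Y π ξ →
        ∃ π' : ∀ i : I, I → Set (Y i),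
          (∀ i j, i ≠ j → Metric.hausdorffDist (π i j) (π' i j) ≤ ε) ∧
          StrongProjectionSystem Y π' ξ' := by
  intro ξ h0
  refine ⟨10 * ξ, 2 * ξ, by linarith, by linarith, ?_⟩
  intro I Y _ π h
  have hd := h.isProjectionDist h0
  set d : I → I → I → ℝ := fun j a b => Metric.diam (π j a ∪ π j b) with hd_def
  have hdist : ∀ i j k, j ≠ i → k ≠ i → ∀ x ∈ π i j, ∀ y ∈ π i k, dist x y ≤ d i j k :=
    fun i j k hj hk x hx y hy => Metric.dist_le_diam_of_mem
      ((h.1 i j hj.symm).2.union (h.1 i k hk.symm).2) (Or.inl hx) (Or.inr hy)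
  let π' : ∀ i : I, I → Set (Y i) := fun i j =>
    ⋃ l ∈ {l | (betweennessGraph d i (6 * ξ)).Reachable j l}, π i l
  have hmem : ∀ i j x, x ∈ π' i j ↔
      ∃ l, (betweennessGraph d i (6 * ξ)).Reachable j l ∧ x ∈ π i l := fun i j x => by
    simp [π']
  have hsub : ∀ i j, π i j ⊆ π' i j := fun i j x hx =>
    (hmem i j x).2 ⟨j, SimpleGraph.Reachable.refl j, hx⟩
  have hclass : ∀ i j, j ≠ i → ∀ x ∈ π' i j, ∀ y ∈ π' i j, dist x y ≤ 2 * ξ := by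
    intro i j hj x hx y hy
    obtain ⟨l, hl, hx⟩ := (hmem i j x).1 hx
    obtain ⟨m, hm, hy⟩ := (hmem i j y).1 hy
    have hl' := ne_of_reachable_betweennessGraph hj hl
    have hm' := ne_of_reachable_betweennessGraph hj hm
    exact (hdist i l m hl' hm' x hx y hy).trans (hd.le_of_reachable hl' (hl.symm.trans hm))
  have hcross : ∀ i j k, j ≠ i → k ≠ i → ∀ x ∈ π' i j, ∀ y ∈ π' i k,
      dist x y ≤ d i j k + 4 * ξ := by
    intro i j k hj hk x hx y hy
    obtain ⟨u, hu⟩ := (h.1 i j hj.symm).1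
    obtain ⟨v, hv⟩ := (h.1 i k hk.symm).1
    linarith [dist_triangle4 x u v y, hclass i j hj x hx u (hsub i j hu),
      hclass i k hk v (hsub i k hv) y hy, hdist i j k hj hk u hu v hv]
  have hdiam : ∀ i j k, j ≠ i → k ≠ i →
      Metric.diam (π' i j ∪ π' i k) ≤ d i j k + 4 * ξ := by
    intro i j k hj hk
    have hnn : 0 ≤ d i j k := Metric.diam_nonneg
    refine Metric.diam_le_of_forall_dist_le (by linarith) ?_
    rintro x (hx | hx) y (hy | hy)
    · linarith [hclass i j hj x hx y hy]
    · exact hcross i j k hj hk x hx y hy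
    · rw [dist_comm]
      exact hcross i j k hj hk y hy x hx
    · linarith [hclass i k hk x hx y hy]
  refine ⟨π', fun i j hij => ?_, fun i j hij => ⟨?_, ?_⟩, fun i j hij => ?_,
    fun i j k hij hjk hik hlt => ?_, fun i k hik => ?_⟩
  · refine Metric.hausdorffDist_le_of_mem_dist (by linarith)
      (fun x hx => ⟨x, hsub i j hx, by simpa using h0⟩) fun x hx => ?_
    obtain ⟨u, hu⟩ := (h.1 i j hij).1
    exact ⟨u, hu, hclass i j hij.symm x hx u (hsub i j hu)⟩
  · exact (h.1 i j hij).1.mono (hsub i j)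
  · exact Metric.isBounded_iff.2 ⟨2 * ξ, fun x hx y hy => hclass i j hij.symm x hx y hy⟩
  · refine Metric.diam_le_of_forall_dist_le (by linarith) fun x hx y hy => ?_
    linarith [hclass i j hij.symm x hx y hy]
  · have hadj : (betweennessGraph d i (6 * ξ)).Adj j k :=
      ⟨hij.symm, hik.symm, hjk, Or.inl (by linarith [hdiam j i k hij hjk.symm])⟩
    ext x
    rw [hmem, hmem]
    exact exists_congr fun l => and_congr_left fun _ =>
      ⟨hadj.reachable.symm.trans, hadj.reachable.trans⟩
  · refine (h.2.2.2 i k hik).subset fun j hj => ⟨hj.1, hj.2.1, ?_⟩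
    have hlt : 10 * ξ < Metric.diam (π' j i ∪ π' j k) := hj.2.2
    have hle := hdiam j i k hj.1.symm hj.2.1.symm
    change ξ < d j i k
    linarith
end

section
/- For all δ ≥ 0, λ ≥ 1, c ≥ 0 and all functions R, N : [0,∞) → [0,∞), there exists θ > 0 such that the following holds. Let Y be a geodesic δ-hyperbolic metric space and H a group acting on Y by isometries with kernel K = {g ∈ H : g·y = y for all y ∈ Y}, such that for every r ≥ 0 and all a, b ∈ Y with d(a,b) ≥ R(r), the set of cosets {gK : d(g·a,a) ≤ r and d(g·b,b) ≤ r} has at most N(r) elements. Let g ∈ H be a loxodromic element and let A ⊆ Y be a (λ,c)-quasi-axis for g, and set EC(g) = {h ∈ H : the Hausdorff distance between h·A and A is finite} (a subgroup of H). Then there exists a finite subset F ⊆ H such that the set {h ∈ H : diam π_A(h·A) ≥ θ} is contained in the finite union of double cosets ⋃_{f∈F} EC(g)·f·EC(g), where π_A(S) denotes the set of all 1-approximate nearest points on A of points of S. -/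
open Pointwise

/-- `γ` is a `(lam, c)`-quasi-geodesic on the interval `I ⊆ ℝ`. -/
def IsQuasiGeodesicOn {X : Type*} [MetricSpace X] (lam c : ℝ) (γ : ℝ → X)
    (I : Set ℝ) : Prop :=
  ∀ s ∈ I, ∀ t ∈ I,
    (1 / lam) * |s - t| - c ≤ dist (γ s) (γ t) ∧ dist (γ s) (γ t) ≤ lam * |s - t| + c

/-- The set of all 1-approximate nearest points on `A` of points of `S`. -/
def approxProj {X : Type*} [MetricSpace X] (A S : Set X) : Set X :=
  {p : X | p ∈ A ∧ ∃ s ∈ S, dist s p ≤ Metric.infDist s A + 1}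

/-- The point `p` lies on a geodesic from `x` to `y`. -/
def MetricBetween {X : Type*} [MetricSpace X] (x p y : X) : Prop :=
  dist x p + dist p y = dist x y

/-- Thinness of geodesic triangles, phrased through metric betweenness. -/
def HasThinTriangles (X : Type*) [MetricSpace X] (δ : ℝ) : Prop :=
  ∀ x y z p : X, MetricBetween x p y →
    ∃ q, (MetricBetween y q z ∨ MetricBetween x q z) ∧ dist p q ≤ δ

/-- Every point on a geodesic between two points of `A` is `M`-close to `A`. -/
def IsMetricQuasiconvex {X : Type*} [MetricSpace X] (M : ℝ) (A : Set X) : Prop :=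
  ∀ x ∈ A, ∀ y ∈ A, ∀ w, MetricBetween x w y → ∃ a ∈ A, dist w a ≤ M

section Hyperbolic

variable {X : Type*} [MetricSpace X]

theorem MetricBetween.symm {x p y : X} (h : MetricBetween x p y) : MetricBetween y p x := by
  unfold MetricBetween at *
  rw [dist_comm y p, dist_comm p x, dist_comm y x]
  linarith

theorem IsGeodesicFrom.metricBetween {γ : ℝ → X} {x y : X} (h : IsGeodesicFrom γ x y)
    {t : ℝ} (ht : t ∈ Set.Icc (0 : ℝ) (dist x y)) :
    dist x (γ t) = t ∧ MetricBetween x (γ t) y := by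
  obtain ⟨h0, h1, h2⟩ := h
  have e1 := h2 0 ⟨le_rfl, dist_nonneg⟩ t ht
  have e2 := h2 t ht (dist x y) ⟨dist_nonneg, le_rfl⟩
  rw [h0, zero_sub, abs_neg, abs_of_nonneg ht.1] at e1
  rw [h1, abs_sub_comm, abs_of_nonneg (by linarith [ht.2])] at e2
  refine ⟨e1, ?_⟩
  unfold MetricBetween
  linarith

theorem IsGeodesicSpace.exists_metricBetween (hX : IsGeodesicSpace X) (x y : X) {t : ℝ}
    (h0 : 0 ≤ t) (h1 : t ≤ dist x y) : ∃ p, dist x p = t ∧ MetricBetween x p y := by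
  obtain ⟨γ, hγ⟩ := hX x y
  exact ⟨γ t, hγ.metricBetween ⟨h0, h1⟩⟩

theorem IsGeodesicSpace.exists_geodesic_through (hX : IsGeodesicSpace X) {x p y : X}
    (hp : MetricBetween x p y) : ∃ γ : ℝ → X, IsGeodesicFrom γ x y ∧ γ (dist x p) = p := by
  obtain ⟨σ, hσ0, hσ1, hσ⟩ := hX x p
  obtain ⟨τ, hτ0, hτ1, hτ⟩ := hX p y
  unfold MetricBetween at hp
  set a := dist x p with ha
  have ha0 : 0 ≤ a := dist_nonneg
  have hb0 : 0 ≤ dist p y := dist_nonneg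
  have key : ∀ s ∈ Set.Icc (0 : ℝ) (dist x y), ∀ t ∈ Set.Icc (0 : ℝ) (dist x y), s ≤ t →
      dist (if s ≤ a then σ s else τ (s - a)) (if t ≤ a then σ t else τ (t - a)) = |s - t| := by
    intro s hs t ht hst
    rcases le_or_gt t a with hta | hta
    · rw [if_pos (hst.trans hta), if_pos hta]
      exact hσ s ⟨hs.1, hst.trans hta⟩ t ⟨ht.1, hta⟩
    · rw [if_neg hta.not_ge]
      have ht' : t - a ∈ Set.Icc (0 : ℝ) (dist p y) := ⟨by linarith, by linarith [ht.2]⟩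
      rcases le_or_gt s a with hsa | hsa
      · rw [if_pos hsa, abs_sub_comm, abs_of_nonneg (by linarith)]
        have hs' : s ∈ Set.Icc (0 : ℝ) a := ⟨hs.1, hsa⟩
        have e1 := hσ 0 ⟨le_rfl, ha0⟩ s hs'
        have e2 := hσ s hs' a ⟨ha0, le_rfl⟩
        have e3 := hτ 0 ⟨le_rfl, hb0⟩ (t - a) ht'
        have e4 := hτ (t - a) ht' (dist p y) ⟨hb0, le_rfl⟩
        rw [hσ0, zero_sub, abs_neg, abs_of_nonneg hs.1] at e1
        rw [hσ1, abs_sub_comm, abs_of_nonneg (by linarith)] at e2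
        rw [hτ0, zero_sub, abs_neg, abs_of_nonneg ht'.1] at e3
        rw [hτ1, abs_sub_comm, abs_of_nonneg (by linarith [ht'.2])] at e4
        have t1 := dist_triangle (σ s) p (τ (t - a))
        have t2 := dist_triangle4 x (σ s) (τ (t - a)) y
        linarith
      · rw [if_neg hsa.not_ge, hτ (s - a) ⟨by linarith, by linarith [hs.2]⟩ (t - a) ht']
        congr 1
        ring
  refine ⟨fun t => if t ≤ a then σ t else τ (t - a), ⟨?_, ?_, ?_⟩, ?_⟩
  · simp [ha0, hσ0]
  · rcases le_or_gt (dist x y) a with h | h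
    · have hpy : p = y := dist_le_zero.1 (by linarith)
      have hxy : dist x y = a := by rw [ha, hpy]
      simp only [hxy, le_refl, if_true, hσ1]
      exact hpy
    · simp only [if_neg h.not_ge]
      rw [← hp, add_sub_cancel_left, hτ1]
  · intro s hs t ht
    rcases le_total s t with h | h
    · exact key s hs t ht h
    · rw [dist_comm, abs_sub_comm]
      exact key t ht s hs h
  · simp [hσ1]

theorem IsDeltaHyperbolic.hasThinTriangles {δ : ℝ} (hX : IsGeodesicSpace X)
    (hδ : IsDeltaHyperbolic X δ) : HasThinTriangles X δ := by
  intro x y z p hp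
  obtain ⟨γ₁, h₁, hγp⟩ := hX.exists_geodesic_through hp
  obtain ⟨γ₂, h₂⟩ := hX y z
  obtain ⟨γ₃, h₃⟩ := hX x z
  have hp0 : 0 ≤ dist p y := dist_nonneg
  obtain ⟨q, hq, hpq⟩ := hδ x y z γ₁ γ₂ γ₃ h₁ h₂ h₃ p
    ⟨dist x p, ⟨dist_nonneg, by unfold MetricBetween at hp; linarith⟩, hγp⟩
  refine ⟨q, ?_, hpq⟩
  rcases hq with ⟨t, ht, rfl⟩ | ⟨t, ht, rfl⟩
  · exact Or.inl (h₂.metricBetween ht).2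
  · exact Or.inr (h₃.metricBetween ht).2

theorem HasThinTriangles.quadrilateral {δ : ℝ} (hδ0 : 0 ≤ δ) (hX : HasThinTriangles X δ)
    {p q s t u : X} (hu : MetricBetween p u q) :
    ∃ w, (MetricBetween s w p ∨ MetricBetween s w t ∨ MetricBetween t w q) ∧
      dist u w ≤ 2 * δ := by
  obtain ⟨w, hw, huw⟩ := hX p q s u hu
  rcases hw with hw | hw
  · obtain ⟨v, hv, hwv⟩ := hX q s t w hw
    refine ⟨v, ?_, by linarith [dist_triangle u w v]⟩
    rcases hv with hv | hv
    · exact Or.inr (Or.inl hv)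
    · exact Or.inr (Or.inr hv.symm)
  · exact ⟨w, Or.inl hw.symm, by linarith⟩

theorem exists_natural_bound_of_two_pow_le (a b : ℝ) :
    ∃ K : ℕ, ∀ n : ℕ, (2 : ℝ) ^ n ≤ a * n + b → n ≤ K := by
  have h1 : Filter.Tendsto (fun n : ℕ => a * ((n : ℝ) ^ 1 * (1 / 2 : ℝ) ^ n)
      + b * (1 / 2 : ℝ) ^ n) Filter.atTop (nhds (a * 0 + b * 0)) :=
    ((tendsto_pow_const_mul_const_pow_of_abs_lt_one 1 (by norm_num [abs_of_pos])).const_mul a).add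
      ((tendsto_pow_atTop_nhds_zero_of_lt_one (by norm_num) (by norm_num)).const_mul b)
  have h2 := h1.eventually (gt_mem_nhds (show a * 0 + b * 0 < (1 : ℝ) by norm_num))
  obtain ⟨K, hK⟩ := Filter.eventually_atTop.1 h2
  refine ⟨K, fun n hn => ?_⟩
  by_contra! hlt
  have h3 := hK n hlt.le
  have h4 : (0 : ℝ) < 2 ^ n := by positivity
  have h5 : a * ((n : ℝ) ^ 1 * (1 / 2 : ℝ) ^ n) + b * (1 / 2 : ℝ) ^ n
      = (a * n + b) / 2 ^ n := by
    rw [one_div, inv_pow]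
    field_simp
  rw [h5, div_lt_one h4] at h3
  linarith

/-- Bisecting the parameter interval: geodesics between points of a quasi-geodesic stay
logarithmically close to it. -/
theorem IsQuasiGeodesicOn.exists_dist_le_of_abs_le_two_pow {δ lam c : ℝ} (hlam : 0 ≤ lam)
    (hX : HasThinTriangles X δ) {γ : ℝ → X} (hγ : IsQuasiGeodesicOn lam c γ Set.univ)
    (k : ℕ) : ∀ (s t : ℝ) (w : X), |s - t| ≤ 2 ^ k → MetricBetween (γ s) w (γ t) →
      ∃ u, dist w (γ u) ≤ k * δ + lam + c := by
  induction k with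
  | zero =>
    intro s t w hst hw
    refine ⟨s, ?_⟩
    have h1 := (hγ s trivial t trivial).2
    have h2 : lam * |s - t| ≤ lam * 1 := mul_le_mul_of_nonneg_left (by simpa using hst) hlam
    unfold MetricBetween at hw
    rw [dist_comm]
    have : 0 ≤ dist w (γ t) := dist_nonneg
    push_cast
    linarith
  | succ k ih =>
    intro s t w hst hw
    rw [pow_succ] at hst
    obtain ⟨q, hq, hwq⟩ := hX _ _ (γ ((s + t) / 2)) w hw
    have e1 : |t - (s + t) / 2| ≤ 2 ^ k := by
      rw [show t - (s + t) / 2 = -((s - t) / 2) by ring, abs_neg, abs_div, abs_two]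
      linarith
    have e2 : |s - (s + t) / 2| ≤ 2 ^ k := by
      rw [show s - (s + t) / 2 = (s - t) / 2 by ring, abs_div, abs_two]
      linarith
    obtain ⟨u, hu⟩ : ∃ u, dist q (γ u) ≤ k * δ + lam + c := by
      rcases hq with hq | hq
      · exact ih _ _ q e1 hq
      · exact ih _ _ q e2 hq
    refine ⟨u, ?_⟩
    push_cast
    linarith [dist_triangle w q (γ u)]

/-- On the geodesic from `p ∈ A` to `x`, either go back a distance `2 * D` or stop at `p`, and
connect the point reached to `A` while staying far from `x`. -/
theorem exists_metricBetween_detour {A : Set X} (hX : IsGeodesicSpace X) {p x : X} (hp : p ∈ A)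
    {D : ℝ} (hD : 0 ≤ D) (hx : D - 1 ≤ Metric.infDist x A)
    (hA : ∀ y, MetricBetween p y x → Metric.infDist y A ≤ D) :
    ∃ y y', y' ∈ A ∧ MetricBetween p y x ∧ dist y x ≤ 2 * D ∧ dist y y' ≤ D + 1 ∧
      ∀ w, MetricBetween y w y' → D - 1 ≤ dist x w := by
  rcases le_or_gt (dist p x) (2 * D) with h | h
  · refine ⟨p, p, hp, by simp [MetricBetween], h, by simpa using by linarith, ?_⟩
    intro w hw
    have hpw : p = w := by
      unfold MetricBetween at hw
      rw [dist_self] at hw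
      exact dist_le_zero.1 (by linarith [dist_nonneg (x := w) (y := p)])
    rw [← hpw]
    exact hx.trans (Metric.infDist_le_dist_of_mem hp)
  · obtain ⟨y, hy1, hy2⟩ := hX.exists_metricBetween x p (t := 2 * D) (by linarith)
      (by rw [dist_comm]; exact h.le)
    obtain ⟨y', hy', hyy'⟩ := (Metric.infDist_lt_iff ⟨p, hp⟩).1
      (lt_of_le_of_lt (hA y hy2.symm) (lt_add_one D))
    refine ⟨y, y', hy', hy2.symm, by rw [dist_comm, hy1], hyy'.le, ?_⟩
    intro w hw
    unfold MetricBetween at hw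
    have := dist_triangle x w y
    rw [dist_comm w y] at this
    linarith [dist_nonneg (x := w) (y := y')]

/-- Geodesics between points of a quasi-geodesic line stay uniformly close to it. -/
theorem exists_isMetricQuasiconvex_range {δ lam c : ℝ} (hδ0 : 0 ≤ δ) (hlam : 1 ≤ lam)
    (hc : 0 ≤ c) :
    ∃ M : ℝ, 0 ≤ M ∧ ∀ (Y : Type*) [MetricSpace Y], IsGeodesicSpace Y → HasThinTriangles Y δ →
      ∀ γ : ℝ → Y, IsQuasiGeodesicOn lam c γ Set.univ →
        IsMetricQuasiconvex M (Set.range γ) := by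
  obtain ⟨K, hK⟩ := exists_natural_bound_of_two_pow_le (lam * 6 * δ)
    (lam * (6 * (1 + 2 * δ + δ + lam + c) + 2 + c))
  refine ⟨1 + (1 + 2 * δ + (K + 1) * δ + lam + c), by positivity, ?_⟩
  intro Y _ hY hthin γ hγ x hx y hy w hw
  set A := Set.range γ
  have hAne : A.Nonempty := ⟨x, hx⟩
  set S := (fun w => Metric.infDist w A) '' {w | MetricBetween x w y} with hS
  have hSbdd : BddAbove S := by
    refine ⟨dist x y, ?_⟩
    rintro _ ⟨v, hv, rfl⟩
    have h1 : Metric.infDist v A ≤ dist v x := Metric.infDist_le_dist_of_mem hx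
    have h2 : dist x v + dist v y = dist x y := hv
    rw [dist_comm] at h1
    show Metric.infDist v A ≤ dist x y
    linarith [dist_nonneg (x := v) (y := y)]
  have hSne : S.Nonempty := ⟨_, w, hw, rfl⟩
  set D := sSup S with hD
  have hle : ∀ v, MetricBetween x v y → Metric.infDist v A ≤ D :=
    fun v hv => le_csSup hSbdd ⟨v, hv, rfl⟩
  have hD0 : 0 ≤ D := Metric.infDist_nonneg.trans (hle w hw)
  obtain ⟨_, ⟨v, hv, rfl⟩, hvD⟩ := exists_lt_of_lt_csSup hSne (sub_one_lt D)
  replace hv : MetricBetween x v y := hv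
  replace hvD : D - 1 < Metric.infDist v A := hvD
  suffices hDM : D ≤ 1 + 2 * δ + (K + 1) * δ + lam + c by
    obtain ⟨a, ha, hwa⟩ := (Metric.infDist_lt_iff hAne).1
      (lt_of_le_of_lt (hle w hw) (lt_add_one D))
    exact ⟨a, ha, by linarith⟩
  have mono1 : ∀ u, MetricBetween x u v → MetricBetween x u y := by
    intro u hu
    unfold MetricBetween at *
    linarith [dist_triangle x u y, dist_triangle u v y]
  have mono2 : ∀ u, MetricBetween y u v → MetricBetween x u y := by
    intro u hu
    unfold MetricBetween at *
    rw [dist_comm y u, dist_comm y v] at hu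
    linarith [dist_triangle x u y, dist_triangle x v u, dist_comm u v]
  obtain ⟨y₁, a₁, ha₁, hb₁, hd₁, he₁, hf₁⟩ :=
    exists_metricBetween_detour hY hx hD0 hvD.le (fun u hu => hle u (mono1 u hu))
  obtain ⟨y₂, a₂, ha₂, hb₂, hd₂, he₂, hf₂⟩ :=
    exists_metricBetween_detour hY hy hD0 hvD.le (fun u hu => hle u (mono2 u hu))
  have hbv : MetricBetween y₁ v y₂ := by
    unfold MetricBetween at *
    linarith [dist_triangle y₁ v y₂, dist_triangle4 x y₁ y₂ y, dist_comm y y₂, dist_comm y v,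
      dist_comm y₂ v]
  obtain ⟨t₁, rfl⟩ := ha₁
  obtain ⟨t₂, rfl⟩ := ha₂
  have hda : dist (γ t₁) (γ t₂) ≤ 6 * D + 2 := by
    linarith [dist_triangle4 (γ t₁) y₁ y₂ (γ t₂), dist_triangle y₁ v y₂, dist_comm (γ t₁) y₁,
      dist_comm y₂ v]
  have hlam0 : 0 < lam := by linarith
  have hpar : |t₁ - t₂| ≤ lam * (6 * D + 2 + c) := by
    have h1 := (hγ t₁ trivial t₂ trivial).1
    have h2 : |t₁ - t₂| = lam * (1 / lam * |t₁ - t₂|) := by field_simp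
    rw [h2]
    exact mul_le_mul_of_nonneg_left (by linarith) hlam0.le
  have hone : 1 ≤ lam * (6 * D + 2 + c) := by nlinarith
  obtain ⟨n, hn1, hn2⟩ := exists_nat_pow_near hone (one_lt_two (α := ℝ))
  have hbound : D ≤ 1 + 2 * δ + (n + 1) * δ + lam + c := by
    have hn0 : 0 ≤ (n + 1) * δ := by positivity
    obtain ⟨w', hw', hvw'⟩ := hthin.quadrilateral hδ0 (s := γ t₁) (t := γ t₂) hbv
    rcases hw' with h | h | h
    · linarith [hf₁ w' h.symm]
    · obtain ⟨u, hu⟩ := hγ.exists_dist_le_of_abs_le_two_pow hlam0.le hthin (n + 1) t₁ t₂ w'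
        (hpar.trans hn2.le) h
      have h3 : Metric.infDist v A ≤ dist v (γ u) := Metric.infDist_le_dist_of_mem ⟨u, rfl⟩
      push_cast at hu
      linarith [dist_triangle v w' (γ u)]
    · linarith [hf₂ w' h.symm]
  have hnK : (n : ℝ) ≤ K := by
    refine Nat.cast_le.2 (hK n (hn1.trans ?_))
    have := mul_le_mul_of_nonneg_left hbound hlam0.le
    linarith
  have := mul_le_mul_of_nonneg_right hnK hδ0
  linarith

/-- Two far apart approximate projections of points of `B` to `A` produce two pairs of close
points of `A` and `B` whose mutual distance is under control. -/
theorem exists_close_pairs_of_approxProj {δ M T : ℝ} (hδ0 : 0 ≤ δ) (hM : 0 ≤ M) (hT : 0 ≤ T)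
    (hX : IsGeodesicSpace X) (hthin : HasThinTriangles X δ) {A B : Set X}
    (hA : IsMetricQuasiconvex M A) (hB : IsMetricQuasiconvex M B) {p q : X}
    (hp : p ∈ approxProj A B) (hq : q ∈ approxProj A B)
    (hpq : 2 * (2 + M + 4 * δ) + T ≤ dist p q) :
    ∃ a ∈ A, ∃ b ∈ A, ∃ a' ∈ B, ∃ b' ∈ B, dist a a' ≤ 2 * M + 2 * δ ∧
      dist b b' ≤ 2 * M + 2 * δ ∧ T - 2 * M ≤ dist a b ∧ dist a b ≤ T + 2 * M := by
  obtain ⟨hpA, s, hs, hsp⟩ := hp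
  obtain ⟨hqA, t, ht, htq⟩ := hq
  have far : ∀ {x y u w : X}, dist x y ≤ Metric.infDist x A + 1 → (∃ a ∈ A, dist u a ≤ M) →
      MetricBetween x w y → dist u w ≤ 2 * δ → dist u y < 2 + M + 4 * δ := by
    rintro x y u w hxy ⟨a, ha, hua⟩ hw huw
    have h1 : Metric.infDist x A ≤ dist x a := Metric.infDist_le_dist_of_mem ha
    unfold MetricBetween at hw
    linarith [dist_triangle4 x w u a, dist_triangle u w y, dist_comm u w]
  have close : ∀ u, MetricBetween p u q → 2 + M + 4 * δ ≤ dist u p → 2 + M + 4 * δ ≤ dist u q →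
      ∃ a ∈ A, ∃ a' ∈ B, dist u a ≤ M ∧ dist a a' ≤ 2 * M + 2 * δ := by
    intro u hu hup huq
    obtain ⟨a, ha, hua⟩ := hA p hpA q hqA u hu
    obtain ⟨w, hw, huw⟩ := hthin.quadrilateral hδ0 (s := s) (t := t) hu
    rcases hw with h | h | h
    · exact absurd (far hsp ⟨a, ha, hua⟩ h huw) hup.not_gt
    · obtain ⟨a', ha', hwa'⟩ := hB s hs t ht w h
      exact ⟨a, ha, a', ha', hua,
        by linarith [dist_triangle4 a u w a', dist_comm a u]⟩
    · exact absurd (far htq ⟨a, ha, hua⟩ h huw) huq.not_gt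
  obtain ⟨v, hv1, hv2⟩ := hX.exists_metricBetween p q (t := 2 + M + 4 * δ + T) (by positivity)
    (by linarith)
  obtain ⟨u, hu1, hu2⟩ := hX.exists_metricBetween p v (t := 2 + M + 4 * δ) (by positivity)
    (by linarith)
  unfold MetricBetween at hv2 hu2
  have huq : MetricBetween p u q := by
    unfold MetricBetween
    linarith [dist_triangle p u q, dist_triangle u v q]
  obtain ⟨a, ha, a', ha', hua, haa'⟩ := close u huq (by rw [dist_comm, hu1])
    (by unfold MetricBetween at huq; linarith)
  obtain ⟨b, hb, b', hb', hvb, hbb'⟩ := close v hv2 (by rw [dist_comm, hv1]; linarith)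
    (by linarith)
  exact ⟨a, ha, b, hb, a', ha', b', hb', haa', hbb',
    by linarith [dist_triangle4 u a b v, dist_comm b v],
    by linarith [dist_triangle4 a u v b, dist_comm a u]⟩

end Hyperbolic

theorem not_exists_nonneg_quasiline {u : ℤ → ℝ} (hu : ∀ n, 0 ≤ u n) {J C₁ C₂ : ℝ}
    (hC₁ : 0 < C₁) (hJ : ∀ n, |u (n + 1) - u n| ≤ J)
    (hC : ∀ m n : ℤ, |(m : ℝ) - n| ≤ C₁ * |u m - u n| + C₂) : False := by
  have large : ∀ (B : ℝ) (m : ℤ), 0 ≤ B → C₁ * (u 0 + B) + C₂ < |(m : ℝ)| → B < u m := by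
    intro B m hB hm
    have h1 := hC m 0
    simp only [Int.cast_zero, sub_zero] at h1
    have h2 : u 0 + B < |u m - u 0| := by
      by_contra! h
      linarith [mul_le_mul_of_nonneg_left h hC₁.le]
    rcases abs_cases (u m - u 0) with h | h <;> linarith [hu m, hu 0]
  obtain ⟨N, hN⟩ := exists_nat_gt (max (C₁ * J + C₂) (C₁ * (u 0 + u 0) + C₂))
  have hN1 := (le_max_left _ _).trans_lt hN
  have hN2 := large (u 0) N (hu 0) (by simpa using (le_max_right _ _).trans_lt hN)
  have hex : ∃ k : ℕ, u N < u (-(k : ℤ)) := by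
    obtain ⟨k, hk⟩ := exists_nat_gt (C₁ * (u 0 + u N) + C₂)
    exact ⟨k, large _ _ (hu N) (by simpa using hk)⟩
  classical
  have hk := Nat.find_spec hex
  have hmin := fun m => Nat.find_min hex (m := m)
  set k := Nat.find hex
  rcases Nat.eq_zero_or_pos k with h0 | h0
  · rw [h0] at hk
    simp only [Nat.cast_zero, neg_zero] at hk
    linarith
  · have h1 := hmin (k - 1) (by omega)
    have h2 := hJ (-(k : ℤ))
    rw [show -(k : ℤ) + 1 = -((k - 1 : ℕ) : ℤ) by omega] at h2
    have h3 : |u N - u (-(k : ℤ))| ≤ J := by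
      rw [abs_le] at h2 ⊢
      constructor <;> linarith
    have h4 := hC N (-(k : ℤ))
    push_cast at h4
    rw [sub_neg_eq_add, abs_of_nonneg (by positivity)] at h4
    have h5 := mul_le_mul_of_nonneg_left h3 hC₁.le
    have h6 : (0 : ℝ) ≤ k := by positivity
    linarith

theorem zpow_smul_set_eq {Y H : Type*} [Group H] [MulAction H Y] {g : H} {A : Set Y}
    (hA : g • A = A) (n : ℤ) : g ^ n • A = A :=
  MulAction.mem_stabilizer_iff.1
    (zpow_mem (MulAction.mem_stabilizer_iff.2 hA : g ∈ MulAction.stabilizer H A) n)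

section Action

variable {Y H : Type*} [MetricSpace Y] [Group H] [MulAction H Y]

/-- A loxodromic element acts coboundedly on each of its quasi-axes. -/
theorem exists_zpow_smul_dist_le (hiso : ∀ h : H, Isometry (fun y : Y => h • y)) {g : H}
    (hg : ∃ x : Y, ∃ lam' c' : ℝ, 1 ≤ lam' ∧ 0 ≤ c' ∧ ∀ m n : ℤ,
          (1 / lam') * |(m : ℝ) - n| - c' ≤ dist ((g ^ m) • x) ((g ^ n) • x) ∧
          dist ((g ^ m) • x) ((g ^ n) • x) ≤ lam' * |(m : ℝ) - n| + c')
    {lam c : ℝ} (hlam : 1 ≤ lam) {γ : ℝ → Y}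
    (hγ : IsQuasiGeodesicOn lam c γ Set.univ) (hA : g • Set.range γ = Set.range γ) (o : Y)
    (ho : o ∈ Set.range γ) :
    ∃ L : ℝ, ∀ a ∈ Set.range γ, ∃ n : ℤ, dist (g ^ n • a) o ≤ L := by
  obtain ⟨x, lam', c', hlam', hc', hx⟩ := hg
  have hdist : ∀ (h : H) (y z : Y), dist (h • y) (h • z) = dist y z :=
    fun h y z => (hiso h).dist_eq y z
  have hmem : ∀ n : ℤ, ∃ t, γ t = g ^ n • o := by
    intro n
    have : g ^ n • o ∈ g ^ n • Set.range γ := Set.smul_mem_smul_set ho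
    rwa [zpow_smul_set_eq hA n] at this
  choose t ht using hmem
  have hlam0 : 0 < lam := by linarith
  have hlam0' : 0 < lam' := by linarith
  set J := lam * (dist o (g • o) + c) with hJ
  have hstep : ∀ n, |t (n + 1) - t n| ≤ J := by
    intro n
    have h1 := (hγ (t (n + 1)) trivial (t n) trivial).1
    rw [ht, ht, zpow_add_one, mul_smul, hdist, dist_comm] at h1
    have h2 : |t (n + 1) - t n| = lam * (1 / lam * |t (n + 1) - t n|) := by field_simp
    rw [h2]
    exact mul_le_mul_of_nonneg_left (by linarith) hlam0.le
  have hqi : ∀ m n : ℤ, |(m : ℝ) - n| ≤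
      (lam' * lam) * |t m - t n| + lam' * (c + c' + 2 * dist x o) := by
    intro m n
    have h1 := (hx m n).1
    have h2 := (hγ (t m) trivial (t n) trivial).2
    rw [ht, ht] at h2
    have h3 := dist_triangle4 (g ^ m • x) (g ^ m • o) (g ^ n • o) (g ^ n • x)
    rw [hdist, hdist, dist_comm o x] at h3
    have h4 : |(m : ℝ) - n| = lam' * (1 / lam' * |(m : ℝ) - n|) := by field_simp
    have h5 : lam' * (1 / lam' * |(m : ℝ) - n|) ≤
        lam' * (lam * |t m - t n| + (c + c' + 2 * dist x o)) :=
      mul_le_mul_of_nonneg_left (by linarith) hlam0'.le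
    linarith
  refine ⟨lam * J + c, ?_⟩
  rintro _ ⟨τ, rfl⟩
  obtain ⟨n, hn⟩ : ∃ n, |t n - τ| ≤ J := by
    by_contra! hfar
    have side : ∀ n, (0 < t (n + 1) - τ ↔ 0 < t n - τ) := by
      intro n
      have h1 := hfar n
      have h2 := hfar (n + 1)
      have h3 := abs_le.1 (hstep n)
      constructor <;> intro h
      · rw [abs_of_pos h] at h2
        linarith [h3.2]
      · rw [abs_of_pos h] at h1
        linarith [h3.1]
    have side' : ∀ n, (0 < t n - τ ↔ 0 < t 0 - τ) := by
      intro n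
      induction n using Int.induction_on with
      | zero => rfl
      | succ i ih => exact (side i).trans ih
      | pred i ih =>
        have := side (-(i : ℤ) - 1)
        rw [sub_add_cancel] at this
        exact this.symm.trans ih
    have hsub : ∀ m n, |(|t m - τ|) - (|t n - τ|)| = |t m - t n| := by
      intro m n
      by_cases h0 : 0 < t 0 - τ
      · rw [abs_of_pos ((side' m).2 h0), abs_of_pos ((side' n).2 h0)]
        congr 1
        ring
      · rw [abs_of_nonpos (not_lt.1 (fun h => h0 ((side' m).1 h))),
          abs_of_nonpos (not_lt.1 (fun h => h0 ((side' n).1 h))), abs_sub_comm (t m)]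
        congr 1
        ring
    refine not_exists_nonneg_quasiline (u := fun n => |t n - τ|) (fun n => abs_nonneg _)
      (mul_pos hlam0' hlam0) (J := J) (fun n => ?_) (fun m n => ?_)
      (C₂ := lam' * (c + c' + 2 * dist x o))
    · simpa only [hsub] using hstep n
    · simpa only [hsub] using hqi m n
  refine ⟨-n, ?_⟩
  have h1 := (hγ (t n) trivial τ trivial).2
  rw [ht, dist_comm, ← hdist (g ^ (-n)), smul_smul, ← zpow_add, neg_add_cancel, zpow_zero,
    one_smul] at h1
  linarith [mul_le_mul_of_nonneg_left hn hlam0.le]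

theorem IsQuasiGeodesicOn.exists_finite_net {lam c : ℝ} (hlam : 1 ≤ lam) {γ : ℝ → Y}
    (hγ : IsQuasiGeodesicOn lam c γ Set.univ) (o : Y) (ho : o ∈ Set.range γ) (B : ℝ) :
    ∃ P : Set Y, P.Finite ∧ ∀ a ∈ Set.range γ, dist a o ≤ B → ∃ α ∈ P, dist a α ≤ lam + c := by
  obtain ⟨t₀, rfl⟩ := ho
  have hlam0 : 0 < lam := by linarith
  refine ⟨(fun n : ℤ => γ n) '' Set.Icc ⌊t₀ - lam * (B + c)⌋ ⌊t₀ + lam * (B + c)⌋,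
    (Set.finite_Icc _ _).image _, ?_⟩
  rintro _ ⟨t, rfl⟩ ht
  have hpar : |t - t₀| ≤ lam * (B + c) := by
    have h1 := (hγ t trivial t₀ trivial).1
    have h2 : |t - t₀| = lam * (1 / lam * |t - t₀|) := by field_simp
    rw [h2]
    exact mul_le_mul_of_nonneg_left (by linarith) hlam0.le
  rw [abs_le] at hpar
  refine ⟨_, ⟨⌊t⌋, ⟨Int.floor_le_floor (by linarith), Int.floor_le_floor (by linarith)⟩, rfl⟩, ?_⟩
  refine (hγ t trivial ⌊t⌋ trivial).2.trans ?_
  have h1 : |t - ⌊t⌋| ≤ 1 := by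
    rw [abs_of_nonneg (by linarith [Int.floor_le t])]
    linarith [Int.lt_floor_add_one t]
  linarith [mul_le_mul_of_nonneg_left h1 hlam0.le]

/-- Under a finiteness condition on coarse stabilizers, the elements coarsely carrying one pair
of points to another lie in finitely many cosets of the kernel of the action. -/
theorem exists_finite_kernel_cosets (hiso : ∀ h : H, Isometry (fun y : Y => h • y)) {E : ℝ}
    (a b a' b' : Y)
    (hfin : {S : Set H | ∃ g : H, dist (g • a) a ≤ 2 * E ∧ dist (g • b) b ≤ 2 * E ∧
      S = (fun x => g * x) '' {k : H | ∀ y : Y, k • y = y}}.Finite) :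
    ∃ F : Set H, F.Finite ∧ ∀ h : H, dist a (h • a') ≤ E → dist b (h • b') ≤ E →
      ∃ f ∈ F, ∃ k : H, (∀ y : Y, k • y = y) ∧ h = f * k := by
  have hdist : ∀ (h : H) (y z : Y), dist (h • y) (h • z) = dist y z :=
    fun h y z => (hiso h).dist_eq y z
  by_cases hne : ∃ h₀ : H, dist a (h₀ • a') ≤ E ∧ dist b (h₀ • b') ≤ E
  · obtain ⟨h₀, ha₀, hb₀⟩ := hne
    have move : ∀ (h : H) (x x' : Y), dist x (h₀ • x') ≤ E → dist x (h • x') ≤ E →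
        dist ((h * h₀⁻¹) • x) x ≤ 2 * E := by
      intro h x x' h1 h2
      have h3 := dist_triangle ((h * h₀⁻¹) • x) ((h * h₀⁻¹) • h₀ • x') x
      rw [hdist, smul_smul, inv_mul_cancel_right, dist_comm (h • x')] at h3
      linarith
    have hrep : ∀ S : Set H, ∃ f : H, (∃ g : H, dist (g • a) a ≤ 2 * E ∧
        dist (g • b) b ≤ 2 * E ∧ S = (fun x => g * x) '' {k : H | ∀ y : Y, k • y = y}) →
        S = (fun x => f * x) '' {k : H | ∀ y : Y, k • y = y} := by
      intro S
      by_cases hS : ∃ g : H, dist (g • a) a ≤ 2 * E ∧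
        dist (g • b) b ≤ 2 * E ∧ S = (fun x => g * x) '' {k : H | ∀ y : Y, k • y = y}
      · obtain ⟨g, -, -, h⟩ := hS
        exact ⟨g, fun _ => h⟩
      · exact ⟨1, fun h => absurd h hS⟩
    choose rep hrep using hrep
    refine ⟨(fun S => rep S * h₀) '' _, hfin.image _, fun h ha hb => ?_⟩
    have hmem : ∃ g : H, dist (g • a) a ≤ 2 * E ∧ dist (g • b) b ≤ 2 * E ∧
        (fun x => h * h₀⁻¹ * x) '' {k : H | ∀ y : Y, k • y = y} =
          (fun x => g * x) '' {k : H | ∀ y : Y, k • y = y} :=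
      ⟨h * h₀⁻¹, move h a a' ha₀ ha, move h b b' hb₀ hb, rfl⟩
    have h1 := hrep _ hmem
    have h2 : h * h₀⁻¹ ∈ (fun x => h * h₀⁻¹ * x) '' {k : H | ∀ y : Y, k • y = y} :=
      ⟨1, fun y => one_smul H y, mul_one _⟩
    rw [h1] at h2
    obtain ⟨k, hk, hkh⟩ := h2
    refine ⟨_, ⟨_, hmem, rfl⟩, h₀⁻¹ * k * h₀, fun y => ?_, ?_⟩
    · rw [mul_smul, mul_smul, hk, inv_smul_smul]
    · calc h = h * h₀⁻¹ * h₀ := by group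
        _ = _ * k * h₀ := congrArg (· * h₀) hkh.symm
        _ = _ := by simp only [mul_assoc, mul_inv_cancel_left]
  · exact ⟨∅, Set.finite_empty, fun h ha hb => absurd ⟨h, ha, hb⟩ hne⟩

theorem exists_finset_double_cosets (hiso : ∀ h : H, Isometry (fun y : Y => h • y)) {E T : ℝ}
    (hfin : ∀ a b : Y, T ≤ dist a b →
      {S : Set H | ∃ g : H, dist (g • a) a ≤ 2 * E ∧ dist (g • b) b ≤ 2 * E ∧
        S = (fun x => g * x) '' {k : H | ∀ y : Y, k • y = y}}.Finite)
    {g : H} {A P : Set Y} {L B ε E₀ : ℝ} (o : Y) (hgA : g • A = A)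
    (hL : ∀ a ∈ A, ∃ n : ℤ, dist (g ^ n • a) o ≤ L)
    (hP : P.Finite) (hPnet : ∀ a ∈ A, dist a o ≤ L + B → ∃ α ∈ P, dist a α ≤ ε)
    (hB : 0 ≤ B) (hE : E₀ + 2 * ε ≤ E) :
    ∃ F : Finset H, ∀ h : H, ∀ a ∈ A, ∀ b ∈ A, ∀ a' ∈ A, ∀ b' ∈ A,
      dist a (h • a') ≤ E₀ → dist b (h • b') ≤ E₀ → T + 2 * ε ≤ dist a b → dist a b ≤ B →
      dist a' b' ≤ B →
      ∃ f ∈ F, ∃ e₁ e₂ : H, e₁ • A = A ∧ e₂ • A = A ∧ h = e₁ * f * e₂ := by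
  classical
  have hdist : ∀ (h : H) (y z : Y), dist (h • y) (h • z) = dist y z :=
    fun h y z => (hiso h).dist_eq y z
  have hF : ∀ x : (Y × Y) × (Y × Y), ∃ F : Set H, F.Finite ∧ (T ≤ dist x.1.1 x.1.2 →
      ∀ h : H, dist x.1.1 (h • x.2.1) ≤ E → dist x.1.2 (h • x.2.2) ≤ E →
      ∃ f ∈ F, ∃ k : H, (∀ y : Y, k • y = y) ∧ h = f * k) := by
    intro x
    by_cases hx : T ≤ dist x.1.1 x.1.2
    · obtain ⟨F, hF1, hF2⟩ := exists_finite_kernel_cosets hiso x.1.1 x.1.2 x.2.1 x.2.2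
        (hfin _ _ hx)
      exact ⟨F, hF1, fun _ => hF2⟩
    · exact ⟨∅, Set.finite_empty, fun h => absurd h hx⟩
  choose F hF1 hF2 using hF
  have hfinU : (⋃ x ∈ (P ×ˢ P) ×ˢ (P ×ˢ P), F x).Finite :=
    ((hP.prod hP).prod (hP.prod hP)).biUnion fun x _ => hF1 x
  refine ⟨hfinU.toFinset, ?_⟩
  intro h a ha b hb a' ha' b' hb' haa hbb hab1 hab2 hab'
  obtain ⟨i, hi⟩ := hL a ha
  obtain ⟨j, hj⟩ := hL a' ha'
  have hmem : ∀ (n : ℤ) (x : Y), x ∈ A → g ^ n • x ∈ A := by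
    intro n x hx
    have := Set.smul_mem_smul_set (a := g ^ n) hx
    rwa [zpow_smul_set_eq hgA n] at this
  obtain ⟨α, hα, hαa⟩ := hPnet _ (hmem i a ha) (by linarith)
  obtain ⟨β, hβ, hβb⟩ := hPnet _ (hmem i b hb)
    (by linarith [dist_triangle (g ^ i • b) (g ^ i • a) o, hdist (g ^ i) b a, dist_comm a b])
  obtain ⟨α', hα', hαa'⟩ := hPnet _ (hmem j a' ha') (by linarith)
  obtain ⟨β', hβ', hβb'⟩ := hPnet _ (hmem j b' hb')
    (by linarith [dist_triangle (g ^ j • b') (g ^ j • a') o, hdist (g ^ j) b' a', dist_comm a' b'])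
  have near : ∀ x x' ξ ξ' : Y, dist x (h • x') ≤ E₀ → dist (g ^ i • x) ξ ≤ ε →
      dist (g ^ j • x') ξ' ≤ ε → dist ξ ((g ^ i * h * g ^ (-j)) • ξ') ≤ E := by
    intro x x' ξ ξ' h1 h2 h3
    have h4 := dist_triangle4 ξ (g ^ i • x) (g ^ i • h • x') ((g ^ i * h * g ^ (-j)) • ξ')
    have h5 : g ^ i • h • x' = (g ^ i * h * g ^ (-j)) • g ^ j • x' := by
      simp only [smul_smul, mul_assoc, ← zpow_add, neg_add_cancel, zpow_zero, mul_one]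
    rw [hdist] at h4
    rw [h5, hdist, dist_comm ξ (g ^ i • x)] at h4
    linarith
  obtain ⟨f, hf, k, hk, hfk⟩ := hF2 ((α, β), (α', β'))
    (by
      have h1 := dist_triangle4 (g ^ i • a) α β (g ^ i • b)
      rw [hdist, dist_comm β] at h1
      show T ≤ dist α β
      linarith)
    (g ^ i * h * g ^ (-j)) (near a a' α α' haa hαa hαa') (near b b' β β' hbb hβb hβb')
  have hkA : k • A = A := by
    ext y
    simp only [Set.mem_smul_set, hk, exists_eq_right]
  refine ⟨f, ?_, g ^ (-i), k * g ^ j, zpow_smul_set_eq hgA _, ?_, ?_⟩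
  · rw [Set.Finite.mem_toFinset]
    exact Set.mem_biUnion (show ((α, β), (α', β')) ∈ (P ×ˢ P) ×ˢ (P ×ˢ P) from
      ⟨⟨hα, hβ⟩, ⟨hα', hβ'⟩⟩) hf
  · rw [mul_smul, zpow_smul_set_eq hgA, hkA]
  · rw [show g ^ (-i) * f * (k * g ^ j) = g ^ (-i) * (f * k) * g ^ j by group, ← hfk]
    group

end Action

theorem bounded_projection_double_cosets
    (δ lam c : ℝ) (hδ : 0 ≤ δ) (hlam : 1 ≤ lam) (hc : 0 ≤ c)
    (R N : ℝ → ℝ) :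
    ∃ θ : ℝ, 0 < θ ∧
      ∀ (Y : Type*) [MetricSpace Y], IsGeodesicSpace Y → IsDeltaHyperbolic Y δ →
      ∀ (H : Type*) [Group H] [MulAction H Y],
        (∀ h : H, Isometry (fun y : Y => h • y)) →
        -- acylindrical image, quantified by the functions R and N
        (∀ r : ℝ, 0 ≤ r → ∀ a b : Y, R r ≤ dist a b →
          {S : Set H | ∃ g : H, dist (g • a) a ≤ r ∧ dist (g • b) b ≤ r ∧
              S = (fun x => g * x) '' {k : H | ∀ y : Y, k • y = y}}.Finite ∧
          (({S : Set H | ∃ g : H, dist (g • a) a ≤ r ∧ dist (g • b) b ≤ r ∧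
              S = (fun x => g * x) '' {k : H | ∀ y : Y, k • y = y}}.ncard : ℝ) ≤ N r)) →
        ∀ g : H,
        -- g is loxodromic
        (∃ x : Y, ∃ lam' c' : ℝ, 1 ≤ lam' ∧ 0 ≤ c' ∧ ∀ m n : ℤ,
          (1 / lam') * |(m : ℝ) - n| - c' ≤ dist ((g ^ m) • x) ((g ^ n) • x) ∧
          dist ((g ^ m) • x) ((g ^ n) • x) ≤ lam' * |(m : ℝ) - n| + c') →
        ∀ A : Set Y,
        -- A is a (lam, c)-quasi-axis for g
        g • A = A → (∃ γ : ℝ → Y, IsQuasiGeodesicOn lam c γ Set.univ ∧ A = Set.range γ) →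
        ∃ F : Finset H,
          {h : H | θ ≤ Metric.diam (approxProj A (h • A))} ⊆
            ⋃ f ∈ F, {x : H |
              ∃ e₁ ∈ {h : H | EMetric.hausdorffEdist (h • A) A ≠ ⊤},
              ∃ e₂ ∈ {h : H | EMetric.hausdorffEdist (h • A) A ≠ ⊤},
                x = e₁ * f * e₂} := by
  have hlam0 : 0 ≤ lam := by linarith
  obtain ⟨M, hM, hMorse⟩ := exists_isMetricQuasiconvex_range hδ hlam hc
  set E := 2 * M + 2 * δ + 2 * (lam + c) with hE
  set T := max (R (2 * E)) 0 with hT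
  have hT0 : 0 ≤ T := le_max_right _ _
  have hE0 : 0 ≤ E := by positivity
  set T₁ := T + 2 * (lam + c) + 2 * M with hT₁
  have hT₁0 : 0 ≤ T₁ := by positivity
  refine ⟨2 * (2 + M + 4 * δ) + T₁ + 1, by positivity, ?_⟩
  intro Y _ hY hhyp H _ _ hiso hacyl g hg A hgA hAγ
  obtain ⟨γ, hγ, rfl⟩ := hAγ
  have hthin := hhyp.hasThinTriangles hY
  have ho : γ 0 ∈ Set.range γ := ⟨0, rfl⟩
  have hqc := hMorse Y hY hthin γ hγ
  obtain ⟨L, hL⟩ := exists_zpow_smul_dist_le hiso hg hlam hγ hgA (γ 0) ho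
  have hB0 : 0 ≤ T₁ + 2 * M + 2 * E := by positivity
  obtain ⟨P, hP, hPnet⟩ := hγ.exists_finite_net hlam (γ 0) ho (L + (T₁ + 2 * M + 2 * E))
  obtain ⟨F, hF⟩ := exists_finset_double_cosets hiso (E := E) (T := T)
    (fun a b hab => (hacyl (2 * E) (by positivity) a b ((le_max_left _ _).trans hab)).1)
    (γ 0) hgA hL hP hPnet hB0 hE.ge
  refine ⟨F, fun h hh => ?_⟩
  obtain ⟨p, hp, q, hq, hpq⟩ : ∃ p ∈ approxProj (Set.range γ) (h • Set.range γ),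
      ∃ q ∈ approxProj (Set.range γ) (h • Set.range γ),
        2 * (2 + M + 4 * δ) + T₁ ≤ dist p q := by
    by_contra! hcon
    have h1 : Metric.diam (approxProj (Set.range γ) (h • Set.range γ)) ≤
        2 * (2 + M + 4 * δ) + T₁ :=
      Metric.diam_le_of_forall_dist_le (by positivity) fun p hp q hq => (hcon p hp q hq).le
    have h2 : 2 * (2 + M + 4 * δ) + T₁ + 1 ≤
        Metric.diam (approxProj (Set.range γ) (h • Set.range γ)) := hh
    linarith
  have hdist : ∀ y z : Y, dist (h • y) (h • z) = dist y z := fun y z => (hiso h).dist_eq y z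
  have hqc' : IsMetricQuasiconvex M (h • Set.range γ) := by
    have h1 : h • Set.range γ = Set.range (fun t => h • γ t) := by
      rw [← Set.image_smul, ← Set.range_comp]
      rfl
    rw [h1]
    refine hMorse Y hY hthin _ fun s hs t ht => ?_
    simpa only [hdist] using hγ s hs t ht
  obtain ⟨a, ha, b, hb, _, ⟨a', ha', rfl⟩, _, ⟨b', hb', rfl⟩, haa, hbb, hab1, hab2⟩ :=
    exists_close_pairs_of_approxProj hδ hM hT₁0 hY hthin hqc hqc' hp hq hpq
  have hab' : dist a' b' ≤ T₁ + 2 * M + 2 * E := by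
    have h1 := dist_triangle4 (h • a') a b (h • b')
    rw [hdist, dist_comm (h • a')] at h1
    have h2 : 2 * M + 2 * δ ≤ E := by linarith
    have h3 : dist a (h • a') ≤ 2 * M + 2 * δ := haa
    have h4 : dist b (h • b') ≤ 2 * M + 2 * δ := hbb
    linarith
  obtain ⟨f, hf, e₁, e₂, he₁, he₂, hfe⟩ := hF h a ha b hb a' ha' b' hb' haa hbb
    (by linarith) (by linarith) hab'
  refine Set.mem_biUnion hf ⟨e₁, ?_, e₂, ?_, hfe⟩
  · show Metric.hausdorffEDist (e₁ • Set.range γ) (Set.range γ) ≠ ⊤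
    rw [he₁, Metric.hausdorffEDist_self]
    exact ENNReal.zero_ne_top
  · show Metric.hausdorffEDist (e₂ • Set.range γ) (Set.range γ) ≠ ⊤
    rw [he₂, Metric.hausdorffEDist_self]
    exact ENNReal.zero_ne_top
end
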